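/- arXiv:2012.09969 — 2 statements merged into one kernel-verified Lean document; each statement's English description precedes it below -/
import Mathlib

section
/- For α > -1/2, the iterated improper integral ∫_0^∞ x^{-1/2} J_{α+1/2}(x) · (∫_x^∞ y^{-1/2} J_{α-1/2}(y) dy) dx equals 0. -/
open Real Filter MeasureTheory intervalIntegral

/-- The Bessel function of the first kind `J_ν(x)`, via its power series
(for `x > 0`, using `rpow` for the factor `(x/2)^ν`). -/
noncomputable def besselJ (ν x : ℝ) : ℝ :=
  ∑' m : ℕ, ((-1 : ℝ) ^ m / (m.factorial * Real.Gamma (m + ν + 1))) *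
    (x / 2) ^ (2 * m) * (x / 2) ^ (ν : ℝ)

/-- The coefficient of `z ^ m` in the entire function `z ↦ ∑ (-z) ^ m / (m! Γ(m + ν + 1))`. -/
noncomputable def besselCoeff (ν : ℝ) (m : ℕ) : ℝ :=
  (-1 : ℝ) ^ m / (m.factorial * Real.Gamma (m + ν + 1))

/-- The entire function satisfying `J_ν(x) = (x / 2) ^ ν * besselSeries ν (x² / 4)`. -/
noncomputable def besselSeries (ν z : ℝ) : ℝ :=
  ∑' m : ℕ, besselCoeff ν m * z ^ m

lemma besselJ_eq_rpow_mul_besselSeries (ν x : ℝ) :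
    besselJ ν x = (x / 2) ^ ν * besselSeries ν (x ^ 2 / 4) := by
  unfold besselJ besselSeries besselCoeff
  rw [← tsum_mul_left]
  refine tsum_congr fun m => ?_
  rw [pow_mul, show (x / 2) ^ 2 = x ^ 2 / 4 by ring]
  ring

lemma exists_abs_besselCoeff_le {ν : ℝ} (hν : -1 < ν) :
    ∃ M : ℝ, ∀ m : ℕ, |besselCoeff ν m| ≤ M / m.factorial := by
  have hpos : ∀ m : ℕ, 0 < Real.Gamma (m + ν + 1) := fun m =>
    Real.Gamma_pos_of_pos (by have := m.cast_nonneg (α := ℝ); linarith)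
  have hmono : ∀ m : ℕ, Real.Gamma (ν + 2) ≤ Real.Gamma ((m + 1 : ℕ) + ν + 1) := by
    intro m
    induction m with
    | zero => exact (congrArg Real.Gamma (by push_cast; ring)).le
    | succ k ih =>
      refine ih.trans ?_
      have h := hpos (k + 1)
      have hk := k.cast_nonneg (α := ℝ)
      push_cast at h ⊢
      rw [show (k : ℝ) + 1 + 1 + ν + 1 = (k + 1 + ν + 1) + 1 by ring,
        Real.Gamma_add_one (s := (k : ℝ) + 1 + ν + 1) (by linarith)]
      have h1 : 1 ≤ (k : ℝ) + 1 + ν + 1 := by linarith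
      exact le_mul_of_one_le_left h.le h1
  set g := min (Real.Gamma (ν + 1)) (Real.Gamma (ν + 2)) with hg
  have hg0 : 0 < g :=
    lt_min (Real.Gamma_pos_of_pos (by linarith)) (Real.Gamma_pos_of_pos (by linarith))
  have hle : ∀ m : ℕ, g ≤ Real.Gamma (m + ν + 1) := by
    rintro (_ | m)
    · rw [Nat.cast_zero, zero_add]
      exact min_le_left _ _
    · exact (min_le_right _ _).trans (hmono m)
  refine ⟨1 / g, fun m => ?_⟩
  have hf : (0 : ℝ) < m.factorial := by exact_mod_cast m.factorial_pos
  rw [besselCoeff, abs_div, abs_pow, abs_neg, abs_one, one_pow, abs_mul, abs_of_pos hf,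
    abs_of_pos (hpos m), div_div, mul_comm]
  gcongr
  exact hle m

lemma summable_besselCoeff_mul_pow {ν : ℝ} (hν : -1 < ν) (z : ℝ) :
    Summable fun m : ℕ => besselCoeff ν m * z ^ m := by
  obtain ⟨M, hM⟩ := exists_abs_besselCoeff_le hν
  refine .of_norm_bounded ((Real.summable_pow_div_factorial |z|).mul_left M) fun m => ?_
  rw [norm_mul, norm_pow, Real.norm_eq_abs, Real.norm_eq_abs, mul_div_assoc', mul_div_right_comm]
  gcongr
  exact hM m

lemma besselCoeff_succ_mul (ν : ℝ) (m : ℕ) :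
    besselCoeff ν (m + 1) * (m + 1) = -besselCoeff (ν + 1) m := by
  have hm : (m : ℝ) + 1 ≠ 0 := by positivity
  unfold besselCoeff
  rw [Nat.factorial_succ, show ((m + 1 : ℕ) : ℝ) + ν + 1 = m + (ν + 1) + 1 by push_cast; ring,
    Nat.cast_mul, Nat.cast_succ, pow_succ, mul_assoc, div_mul_eq_mul_div, mul_comm _ ((m : ℝ) + 1),
    mul_div_mul_left _ _ hm]
  ring

lemma besselCoeff_eq_mul {ν : ℝ} (hν : -1 < ν) (m : ℕ) :
    besselCoeff ν m = (m + ν + 1) * besselCoeff (ν + 1) m := by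
  have hm : (m : ℝ) + ν + 1 ≠ 0 := by have := m.cast_nonneg (α := ℝ); linarith
  unfold besselCoeff
  rw [show (m : ℝ) + (ν + 1) + 1 = (m + ν + 1) + 1 by ring, Real.Gamma_add_one hm,
    mul_div_assoc', mul_left_comm, mul_div_mul_left _ _ hm]

lemma hasDerivAt_besselSeries {ν : ℝ} (hν : -1 < ν) (z : ℝ) :
    HasDerivAt (besselSeries ν) (-besselSeries (ν + 1) z) z := by
  obtain ⟨M, hM⟩ := exists_abs_besselCoeff_le hν
  have hM0 : 0 ≤ M := by simpa using (abs_nonneg _).trans (hM 0)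
  set R := |z| + 1 with hR
  have hR0 : 0 ≤ R := by positivity
  have hsum : Summable fun m : ℕ => M / m.factorial * (m * R ^ (m - 1)) := by
    rw [← summable_nat_add_iff 1]
    refine ((Real.summable_pow_div_factorial R).mul_left M).congr fun m => ?_
    have hm : (m : ℝ) + 1 ≠ 0 := by positivity
    have hf : (m.factorial : ℝ) ≠ 0 := by exact_mod_cast m.factorial_ne_zero
    rw [Nat.factorial_succ]
    push_cast
    field_simp
  have hz : z ∈ Metric.ball (0 : ℝ) R := by simp [hR]
  have key := hasDerivAt_tsum_of_isPreconnected (𝕜 := ℝ)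
    (g := fun (m : ℕ) (y : ℝ) => besselCoeff ν m * y ^ m)
    (g' := fun (m : ℕ) (y : ℝ) => besselCoeff ν m * (m * y ^ (m - 1))) hsum
    Metric.isOpen_ball (convex_ball (0 : ℝ) R).isPreconnected
    (fun m y _ => (hasDerivAt_pow m y).const_mul _)
    (fun m y hy => by
      have hy' : |y| ≤ R := by simpa using (mem_ball_zero_iff.1 hy).le
      rw [norm_mul, norm_mul, norm_pow, Real.norm_eq_abs, Real.norm_eq_abs, Real.norm_eq_abs,
        Nat.abs_cast]
      gcongr
      exact hM m)
    hz (summable_besselCoeff_mul_pow hν z) hz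
  refine key.congr_deriv ?_
  have hs : Summable fun m : ℕ => besselCoeff ν m * (m * z ^ (m - 1)) := by
    rw [← summable_nat_add_iff 1]
    refine (summable_besselCoeff_mul_pow (ν := ν + 1) (by linarith) z).neg.congr fun m => ?_
    rw [← neg_mul, ← besselCoeff_succ_mul]
    push_cast
    ring
  rw [hs.tsum_eq_zero_add, besselSeries, ← tsum_neg]
  simp only [Nat.cast_zero, zero_mul, mul_zero, zero_add]
  refine tsum_congr fun m => ?_
  rw [← neg_mul, ← besselCoeff_succ_mul]
  push_cast
  ring

lemma besselSeries_eq {ν : ℝ} (hν : -1 < ν) (z : ℝ) :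
    besselSeries ν z = (ν + 1) * besselSeries (ν + 1) z - z * besselSeries (ν + 2) z := by
  have h₁ := summable_besselCoeff_mul_pow (ν := ν + 1) (by linarith) z
  have h₂ := summable_besselCoeff_mul_pow (ν := ν + 2) (by linarith) z
  have hterm : ∀ m : ℕ, besselCoeff (ν + 1) (m + 1) * (m + 1) * z ^ (m + 1) =
      -(z * (besselCoeff (ν + 2) m * z ^ m)) := fun m => by
    rw [besselCoeff_succ_mul, add_assoc, one_add_one_eq_two]
    ring
  have h₃ : Summable fun m : ℕ => besselCoeff (ν + 1) m * m * z ^ m := by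
    rw [← summable_nat_add_iff 1]
    refine (h₂.mul_left z).neg.congr fun m => ?_
    push_cast
    exact (hterm m).symm
  have h₄ : ∑' m : ℕ, besselCoeff (ν + 1) m * m * z ^ m = -(z * besselSeries (ν + 2) z) := by
    rw [h₃.tsum_eq_zero_add, besselSeries, ← tsum_mul_left, ← tsum_neg]
    simp only [Nat.cast_zero, zero_mul, mul_zero, zero_add]
    refine tsum_congr fun m => ?_
    push_cast
    exact hterm m
  rw [sub_eq_add_neg, ← h₄, besselSeries, besselSeries, ← tsum_mul_left,
    ← (h₁.mul_left _).tsum_add h₃]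
  refine tsum_congr fun m => ?_
  rw [besselCoeff_eq_mul hν]
  ring

/-- The first-order linear system satisfied by `u x = √x * J_{α - 1/2}(x)` and
`v x = √x * J_{α + 1/2}(x)` on the positive half-line. -/
structure IsBesselPair (α : ℝ) (u v : ℝ → ℝ) : Prop where
  hasDerivAt_fst : ∀ x, 0 < x → HasDerivAt u (α * u x / x - v x) x
  hasDerivAt_snd : ∀ x, 0 < x → HasDerivAt v (u x - α * v x / x) x

lemma mul_rpow_neg_half_mul_besselJ (ν : ℝ) {x : ℝ} (hx : 0 < x) :
    x * (x ^ (-(1 : ℝ) / 2) * besselJ ν x) =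
      (2 : ℝ) ^ (-ν) * (x ^ (ν + 1 / 2) * besselSeries ν (x ^ 2 / 4)) := by
  rw [besselJ_eq_rpow_mul_besselSeries, Real.div_rpow hx.le two_pos.le, Real.rpow_neg two_pos.le,
    show ν + 1 / 2 = 1 + (-(1 : ℝ) / 2 + ν) by ring, Real.rpow_add hx, Real.rpow_add hx,
    Real.rpow_one]
  field_simp

lemma isBesselPair_besselJ {α : ℝ} (hα : -1 / 2 < α) :
    IsBesselPair α (fun x => x * (x ^ (-(1 : ℝ) / 2) * besselJ (α - 1 / 2) x))
      (fun x => x * (x ^ (-(1 : ℝ) / 2) * besselJ (α + 1 / 2) x)) := by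
  have hν : -1 < α - 1 / 2 := by linarith
  have hser : ∀ ν, -1 < ν → ∀ x : ℝ, HasDerivAt (fun x : ℝ => besselSeries ν (x ^ 2 / 4))
      (-besselSeries (ν + 1) (x ^ 2 / 4) * (x / 2)) x := fun ν h x => by
    have hsq : HasDerivAt (fun x : ℝ => x ^ 2 / 4) (x / 2) x :=
      ((hasDerivAt_pow 2 x).div_const 4).congr_deriv (by norm_num; ring)
    exact (hasDerivAt_besselSeries h (x ^ 2 / 4)).comp x hsq
  have hu : ∀ x : ℝ, 0 < x → x * (x ^ (-(1 : ℝ) / 2) * besselJ (α - 1 / 2) x) =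
      2 * (2 : ℝ) ^ (-(α + 1 / 2)) * (x ^ α * besselSeries (α - 1 / 2) (x ^ 2 / 4)) := by
    intro x hx
    rw [mul_rpow_neg_half_mul_besselJ _ hx, show -(α - 1 / 2) = 1 + -(α + 1 / 2) by ring,
      Real.rpow_add two_pos, Real.rpow_one, sub_add_cancel]
  have hv : ∀ x : ℝ, 0 < x → x * (x ^ (-(1 : ℝ) / 2) * besselJ (α + 1 / 2) x) =
      (2 : ℝ) ^ (-(α + 1 / 2)) * (x ^ (α + 1) * besselSeries (α + 1 / 2) (x ^ 2 / 4)) := by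
    intro x hx
    rw [mul_rpow_neg_half_mul_besselJ _ hx, add_assoc, add_halves]
  constructor
  · intro x hx
    have hd := (((Real.hasDerivAt_rpow_const (p := α) (Or.inl hx.ne')).mul
      (hser _ hν x)).const_mul (2 * (2 : ℝ) ^ (-(α + 1 / 2))))
    refine (hd.congr_of_eventuallyEq ?_).congr_deriv ?_
    · filter_upwards [lt_mem_nhds hx] with y hy using hu y hy
    · rw [hu x hx, hv x hx, Real.rpow_sub_one hx.ne', Real.rpow_add_one hx.ne',
        show α - 1 / 2 + 1 = α + 1 / 2 by ring]
      field_simp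
      ring
  · intro x hx
    have hd := (((Real.hasDerivAt_rpow_const (p := α + 1) (Or.inl hx.ne')).mul
      (hser (α + 1 / 2) (by linarith) x)).const_mul ((2 : ℝ) ^ (-(α + 1 / 2))))
    refine (hd.congr_of_eventuallyEq ?_).congr_deriv ?_
    · filter_upwards [lt_mem_nhds hx] with y hy using hv y hy
    · rw [hu x hx, hv x hx, besselSeries_eq hν, add_sub_cancel_right, Real.rpow_add_one hx.ne',
        show α - 1 / 2 + 1 = α + 1 / 2 by ring, show α - 1 / 2 + 2 = α + 1 / 2 + 1 by ring]
      field_simp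
      ring

lemma exists_abs_mul_rpow_neg_half_mul_besselJ_le {ν : ℝ} (hν : -1 < ν) :
    ∃ C : ℝ, ∀ x : ℝ, 0 < x → x ≤ 1 →
      |x * (x ^ (-(1 : ℝ) / 2) * besselJ ν x)| ≤ C * x ^ (ν + 1 / 2) := by
  have hc : Continuous (besselSeries ν) :=
    continuous_iff_continuousAt.2 fun z => (hasDerivAt_besselSeries hν z).continuousAt
  obtain ⟨M, hM⟩ := (isCompact_Icc (a := (0 : ℝ)) (b := 1)).exists_bound_of_continuousOn
    hc.continuousOn
  refine ⟨(2 : ℝ) ^ (-ν) * M, fun x hx hx1 => ?_⟩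
  rw [mul_rpow_neg_half_mul_besselJ ν hx, abs_mul, abs_mul,
    abs_of_pos (Real.rpow_pos_of_pos two_pos _), abs_of_pos (Real.rpow_pos_of_pos hx _), mul_assoc,
    mul_comm M]
  gcongr
  exact hM _ ⟨by positivity, by nlinarith⟩

lemma intervalIntegrable_of_abs_le {f g : ℝ → ℝ} {a b : ℝ} (hab : a ≤ b)
    (hf : ContinuousOn f (Set.Ioc a b)) (hfg : ∀ x ∈ Set.Ioc a b, |f x| ≤ g x)
    (hg : IntervalIntegrable g volume a b) : IntervalIntegrable f volume a b := by
  rw [intervalIntegrable_iff_integrableOn_Ioc_of_le hab] at hg ⊢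
  exact hg.mono' (hf.aestronglyMeasurable measurableSet_Ioc)
    ((ae_restrict_iff' measurableSet_Ioc).2 (ae_of_all _ hfg))

lemma intervalIntegral_swap_of_abs_le {F : ℝ → ℝ → ℝ} {p q : ℝ → ℝ} {a b c d : ℝ}
    (hab : a ≤ b) (hcd : c ≤ d)
    (hF : ContinuousOn (Function.uncurry F) (Set.Ioc a b ×ˢ Set.Ioc c d))
    (hle : ∀ x ∈ Set.Ioc a b, ∀ y ∈ Set.Ioc c d, |F x y| ≤ p x * q y)
    (hp : IntervalIntegrable p volume a b) (hq : IntervalIntegrable q volume c d) :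
    ∫ x in a..b, ∫ y in c..d, F x y = ∫ y in c..d, ∫ x in a..b, F x y := by
  rw [intervalIntegrable_iff_integrableOn_Ioc_of_le hab] at hp
  rw [intervalIntegrable_iff_integrableOn_Ioc_of_le hcd] at hq
  simp only [intervalIntegral.integral_of_le hab, intervalIntegral.integral_of_le hcd]
  have hms := measurableSet_Ioc (a := a) (b := b) |>.prod (measurableSet_Ioc (a := c) (b := d))
  refine integral_integral_swap ((hp.mul_prod hq).mono' ?_ ?_) <;> rw [Measure.prod_restrict]
  · exact hF.aestronglyMeasurable hms
  · exact (ae_restrict_iff' hms).2 (ae_of_all _ fun z hz => hle z.1 hz.1 z.2 hz.2)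

lemma tendsto_rpow_nhdsGT_zero {r : ℝ} (hr : 0 < r) :
    Tendsto (fun c : ℝ => c ^ r) (nhdsWithin 0 (Set.Ioi 0)) (nhds 0) := by
  have h := (Real.continuousAt_rpow_const 0 r (Or.inr hr.le)).tendsto
  rw [Real.zero_rpow hr.ne'] at h
  exact h.mono_left nhdsWithin_le_nhds

lemma integral_eq_of_hasDerivAt_of_tendsto_zero {F F' : ℝ → ℝ} {b : ℝ} (hb : 0 < b)
    (hF : ∀ x, 0 < x → HasDerivAt F (F' x) x) (hF' : IntervalIntegrable F' volume 0 b)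
    (h0 : Tendsto F (nhdsWithin 0 (Set.Ioi 0)) (nhds 0)) : ∫ x in (0 : ℝ)..b, F' x = F b := by
  rw [intervalIntegral.integral_eq_sub_of_hasDerivAt_of_tendsto hb (fun x hx => hF x hx.1) hF' h0
    ((hF b hb).continuousAt.tendsto.mono_left nhdsWithin_le_nhds), sub_zero]

lemma abs_integral_le_div_of_hasDerivAt {F G H w : ℝ → ℝ} {L A B : ℝ} (hL : 0 < L)
    (hF : ∀ c ∈ Set.Ioo (0 : ℝ) 1, HasDerivAt F (L * G c - H c) c) (hF1 : ContinuousAt F 1)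
    (h0 : Tendsto F (nhdsWithin 0 (Set.Ioi 0)) (nhds 0)) (hFA : |F 1| ≤ A)
    (hG : IntervalIntegrable G volume 0 1) (hHc : ContinuousOn H (Set.Ioc 0 1))
    (hH : ∀ c ∈ Set.Ioc (0 : ℝ) 1, |H c| ≤ B * w c) (hw : IntervalIntegrable w volume 0 1) :
    |∫ c in (0 : ℝ)..1, G c| ≤ (A + B * ∫ c in (0 : ℝ)..1, w c) / L := by
  have hHi := intervalIntegrable_of_abs_le zero_le_one hHc hH (hw.const_mul B)
  have hHle := intervalIntegral.norm_integral_le_of_norm_le (f := H) (g := fun c => B * w c)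
    (μ := volume) zero_le_one (ae_of_all _ fun c hc => hH c hc) (hw.const_mul B)
  have key := intervalIntegral.integral_eq_sub_of_hasDerivAt_of_tendsto one_pos hF
    ((hG.const_mul L).sub hHi) h0 (hF1.tendsto.mono_left nhdsWithin_le_nhds)
  rw [intervalIntegral.integral_sub (hG.const_mul L) hHi, intervalIntegral.integral_const_mul,
    sub_zero] at key
  rw [intervalIntegral.integral_const_mul, Real.norm_eq_abs] at hHle
  rw [le_div_iff₀ hL, mul_comm, ← abs_of_pos hL, ← abs_mul,
    show L * ∫ c in (0 : ℝ)..1, G c = F 1 + ∫ c in (0 : ℝ)..1, H c by linarith]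
  exact (abs_add_le _ _).trans (add_le_add hFA hHle)


lemma IsBesselPair.continuousOn_fst {α : ℝ} {u v : ℝ → ℝ} (h : IsBesselPair α u v) :
    ContinuousOn u (Set.Ioi 0) := fun x hx =>
  (h.hasDerivAt_fst x hx).continuousAt.continuousWithinAt

lemma IsBesselPair.continuousOn_snd {α : ℝ} {u v : ℝ → ℝ} (h : IsBesselPair α u v) :
    ContinuousOn v (Set.Ioi 0) := fun x hx =>
  (h.hasDerivAt_snd x hx).continuousAt.continuousWithinAt

lemma IsBesselPair.exists_sq_add_sq_le {α : ℝ} {u v : ℝ → ℝ} (h : IsBesselPair α u v) :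
    ∃ M : ℝ, ∀ x, 1 ≤ x → 2 * |α| ≤ x → u x ^ 2 + v x ^ 2 ≤ M := by
  set F : ℝ → ℝ := fun x => u x ^ 2 + v x ^ 2 - 2 * α * (u x * v x / x) with hF
  set G : ℝ → ℝ := fun x => F x * Real.exp (2 * |α| / x) with hG
  have hFd : ∀ x, 0 < x → HasDerivAt F (2 * α * (u x * v x) / x ^ 2) x := fun x hx => by
    have hu := h.hasDerivAt_fst x hx
    have hv := h.hasDerivAt_snd x hx
    refine (((hu.pow 2).add (hv.pow 2)).sub
      ((((hu.mul hv).div (hasDerivAt_id x) hx.ne')).const_mul (2 * α))).congr_deriv ?_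
    simp only [id, Pi.mul_apply]
    field_simp
    ring
  have hGd : ∀ x, 0 < x → HasDerivAt G
      ((2 * α * (u x * v x) - 2 * |α| * F x) / x ^ 2 * Real.exp (2 * |α| / x)) x := fun x hx => by
    have hd : HasDerivAt (fun x : ℝ => 2 * |α| / x) (-(2 * |α|) / x ^ 2) x :=
      ((hasDerivAt_inv hx.ne').const_mul (2 * |α|)).congr_deriv (by field_simp)
    refine ((hFd x hx).mul hd.exp).congr_deriv ?_
    ring
  have hab : ∀ x, |2 * α * (u x * v x)| ≤ |α| * (u x ^ 2 + v x ^ 2) := fun x => by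
    rw [mul_comm 2 α, mul_assoc, abs_mul]
    gcongr
    rw [abs_le]
    constructor <;> nlinarith [sq_nonneg (u x + v x), sq_nonneg (u x - v x)]
  have hEF : ∀ x, 0 < x → 2 * |α| ≤ x → u x ^ 2 + v x ^ 2 ≤ 2 * F x := fun x hx hαx => by
    have h1 : 2 * α * (u x * v x / x) ≤ (u x ^ 2 + v x ^ 2) / 2 := by
      rw [mul_div_assoc', div_le_iff₀ hx]
      have := (le_abs_self _).trans (hab x)
      nlinarith [sq_nonneg (u x), sq_nonneg (v x)]
    simp only [hF]
    linarith
  set x₀ := max 1 (2 * |α|) with hx₀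
  have hx₀pos : 0 < x₀ := lt_of_lt_of_le one_pos (le_max_left _ _)
  have hanti : AntitoneOn G (Set.Ici x₀) := by
    refine antitoneOn_of_deriv_nonpos (convex_Ici _)
      (fun x hx => (hGd x (hx₀pos.trans_le hx)).continuousAt.continuousWithinAt)
      (fun x hx => (hGd x (hx₀pos.trans_le (interior_subset hx))).differentiableAt
        |>.differentiableWithinAt) fun x hx => ?_
    have hx' : x₀ ≤ x := interior_subset hx
    have hx0 : 0 < x := hx₀pos.trans_le hx'
    rw [(hGd x hx0).deriv]
    refine mul_nonpos_of_nonpos_of_nonneg (div_nonpos_of_nonpos_of_nonneg ?_ (sq_nonneg _))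
      (Real.exp_pos _).le
    have h1 := (le_abs_self _).trans (hab x)
    have h2 := mul_le_mul_of_nonneg_left (hEF x hx0 ((le_max_right _ _).trans hx')) (abs_nonneg α)
    linarith
  refine ⟨2 * G x₀, fun x hx1 hx2 => ?_⟩
  have hx0 : 0 < x := one_pos.trans_le hx1
  have h1 := hEF x hx0 hx2
  have h2 : F x ≤ G x := le_mul_of_one_le_right (by nlinarith [sq_nonneg (u x), sq_nonneg (v x)])
    (Real.one_le_exp (by positivity))
  have h3 : G x ≤ G x₀ := hanti Set.self_mem_Ici (max_le hx1 hx2) (max_le hx1 hx2)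
  linarith

lemma IsBesselPair.exists_bound {α : ℝ} {u v : ℝ → ℝ} (h : IsBesselPair α u v) :
    ∃ C : ℝ, ∀ x, 1 ≤ x → |u x| ≤ C ∧ |v x| ≤ C := by
  obtain ⟨M, hM⟩ := h.exists_sq_add_sq_le
  have hsub : Set.Icc 1 (2 * |α|) ⊆ Set.Ioi (0 : ℝ) := fun x hx => one_pos.trans_le hx.1
  obtain ⟨A, hA⟩ := isCompact_Icc.exists_bound_of_continuousOn (h.continuousOn_fst.mono hsub)
  obtain ⟨B, hB⟩ := isCompact_Icc.exists_bound_of_continuousOn (h.continuousOn_snd.mono hsub)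
  refine ⟨max (√M) (max A B), fun x hx => ?_⟩
  rcases le_total x (2 * |α|) with hx2 | hx2
  · exact ⟨(hA x ⟨hx, hx2⟩).trans ((le_max_left _ _).trans (le_max_right _ _)),
      (hB x ⟨hx, hx2⟩).trans ((le_max_right _ _).trans (le_max_right _ _))⟩
  · have := hM x hx hx2
    exact ⟨(Real.abs_le_sqrt (by nlinarith [sq_nonneg (v x)])).trans (le_max_left _ _),
      (Real.abs_le_sqrt (by nlinarith [sq_nonneg (u x)])).trans (le_max_left _ _)⟩

/-- A solution of the Bessel system together with bounds near `0` and near `∞`. -/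
structure BoundedBesselPair (α δ C : ℝ) (u v : ℝ → ℝ) : Prop extends IsBesselPair α u v where
  exponent_nonneg : 0 ≤ δ
  exponent_lt : δ < 1 / 2
  neg_le_exponent : -α ≤ δ
  abs_fst_le : ∀ x, 0 < x → |u x| ≤ C * (1 + x ^ (-δ))
  abs_snd_le : ∀ x, 0 < x → |v x| ≤ C
  abs_snd_le_rpow : ∀ x, 0 < x → |v x| ≤ C * x ^ (1 - δ)

lemma IsBesselPair.exists_boundedBesselPair {α A B : ℝ} {u v : ℝ → ℝ} (h : IsBesselPair α u v)
    (hα : -1 / 2 < α) (hA : ∀ x, 0 < x → x ≤ 1 → |u x| ≤ A * x ^ α)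
    (hB : ∀ x, 0 < x → x ≤ 1 → |v x| ≤ B * x ^ (α + 1)) :
    ∃ δ C, BoundedBesselPair α δ C u v := by
  obtain ⟨D, hD⟩ := h.exists_bound
  have hA0 : 0 ≤ A := by simpa using (abs_nonneg _).trans (hA 1 one_pos le_rfl)
  have hB0 : 0 ≤ B := by simpa using (abs_nonneg _).trans (hB 1 one_pos le_rfl)
  have hD0 : 0 ≤ D := (abs_nonneg _).trans (hD 1 le_rfl).1
  have hδ0 : 0 ≤ max 0 (-α) := le_max_left _ _
  have hδ : max 0 (-α) < 1 / 2 := max_lt (by norm_num) (by linarith)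
  have hδα : -α ≤ max 0 (-α) := le_max_right _ _
  set δ := max 0 (-α)
  have hv1 : ∀ x, 0 < x → x ≤ 1 → |v x| ≤ B * x ^ (1 - δ) := fun x hx hx1 =>
    (hB x hx hx1).trans (mul_le_mul_of_nonneg_left
      (Real.rpow_le_rpow_of_exponent_ge hx hx1 (by linarith)) hB0)
  refine ⟨δ, A + B + D, h, hδ0, hδ, hδα, fun x hx => ?_, fun x hx => ?_, fun x hx => ?_⟩
  · have hpos : 0 < x ^ (-δ) := Real.rpow_pos_of_pos hx _
    rcases le_total x 1 with hx1 | hx1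
    · calc |u x| ≤ A * x ^ α := hA x hx hx1
        _ ≤ A * x ^ (-δ) := mul_le_mul_of_nonneg_left
          (Real.rpow_le_rpow_of_exponent_ge hx hx1 (by linarith)) hA0
        _ ≤ (A + B + D) * (1 + x ^ (-δ)) := by gcongr <;> linarith
    · calc |u x| ≤ D := (hD x hx1).1
        _ ≤ (A + B + D) * (1 + x ^ (-δ)) := by nlinarith
  · rcases le_total x 1 with hx1 | hx1
    · have := hv1 x hx hx1
      have := Real.rpow_le_one hx.le hx1 (show 0 ≤ 1 - δ by linarith)
      nlinarith
    · linarith [(hD x hx1).2]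
  · have hpos : 0 < x ^ (1 - δ) := Real.rpow_pos_of_pos hx _
    rcases le_total x 1 with hx1 | hx1
    · have := hv1 x hx hx1
      nlinarith
    · have := Real.one_le_rpow hx1 (show 0 ≤ 1 - δ by linarith)
      have := (hD x hx1).2
      nlinarith

namespace BoundedBesselPair

variable {α δ C : ℝ} {u v I : ℝ → ℝ}

lemma constant_nonneg (h : BoundedBesselPair α δ C u v) : 0 ≤ C :=
  (abs_nonneg _).trans (h.abs_snd_le 1 one_pos)

lemma continuousOn_fst_div (h : BoundedBesselPair α δ C u v) :
    ContinuousOn (fun y => u y / y) (Set.Ioi 0) :=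
  h.continuousOn_fst.div continuousOn_id fun _ hx => (Set.mem_Ioi.1 hx).ne'

lemma intervalIntegrable_fst_div (h : BoundedBesselPair α δ C u v) {x y : ℝ} (hx : 0 < x)
    (hy : 0 < y) : IntervalIntegrable (fun y => u y / y) volume x y :=
  (h.continuousOn_fst_div.mono fun _ hz => (lt_min hx hy).trans_le hz.1).intervalIntegrable

lemma tail_sub_tail (h : BoundedBesselPair α δ C u v)
    (hI : ∀ x, 0 < x → Tendsto (fun L => ∫ y in x..L, u y / y) atTop (nhds (I x)))
    {x y : ℝ} (hx : 0 < x) (hy : 0 < y) : I x - I y = ∫ t in x..y, u t / t := by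
  refine tendsto_nhds_unique ((hI x hx).sub (hI y hy)) (tendsto_const_nhds.congr' ?_)
  filter_upwards [eventually_gt_atTop 0] with L hL
  rw [← intervalIntegral.integral_add_adjacent_intervals (h.intervalIntegrable_fst_div hx hy)
    (h.intervalIntegrable_fst_div hy hL), add_sub_cancel_right]

lemma continuousOn_tail (h : BoundedBesselPair α δ C u v)
    (hI : ∀ x, 0 < x → Tendsto (fun L => ∫ y in x..L, u y / y) atTop (nhds (I x))) :
    ContinuousOn I (Set.Ioi 0) := fun x hx => by
  have hx0 : 0 < x := hx
  have hd : HasDerivAt (fun y => ∫ t in (1 : ℝ)..y, u t / t) (u x / x) x :=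
    intervalIntegral.integral_hasDerivAt_right (h.intervalIntegrable_fst_div one_pos hx0)
      (h.continuousOn_fst_div.stronglyMeasurableAtFilter isOpen_Ioi x hx)
      (h.continuousOn_fst_div.continuousAt (Ioi_mem_nhds hx0))
  refine ContinuousWithinAt.congr (f := fun y => I 1 - ∫ t in (1 : ℝ)..y, u t / t)
    (continuousAt_const.sub hd.continuousAt).continuousWithinAt (fun y hy => ?_) ?_
  · linarith [h.tail_sub_tail hI one_pos hy]
  · linarith [h.tail_sub_tail hI one_pos hx0]

lemma abs_integral_fst_div_le (h : BoundedBesselPair α δ C u v) {x L : ℝ} (hx : 0 < x)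
    (hL : x ≤ L) : |∫ y in x..L, u y / y| ≤ C * (2 + |α + 1|) * x⁻¹ := by
  have hL0 := hx.trans_le hL
  have hC := h.constant_nonneg
  have hpos : ∀ y ∈ Set.uIcc x L, 0 < y := fun y hy => by
    rw [Set.uIcc_of_le hL] at hy
    exact hx.trans_le hy.1
  have hint₁ : IntervalIntegrable (fun y => (α + 1) * v y / y ^ 2) volume x L :=
    ContinuousOn.intervalIntegrable <| ((continuousOn_const.mul
      (h.continuousOn_snd.mono hpos)).div (continuousOn_id.pow 2)
        fun y hy => (pow_pos (hpos y hy) 2).ne')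
  have hint₂ := h.intervalIntegrable_fst_div hx hL0
  have hftc : ∫ y in x..L, (u y / y - (α + 1) * v y / y ^ 2) = v L / L - v x / x := by
    refine intervalIntegral.integral_eq_sub_of_hasDerivAt (f := fun y => v y / y)
      (fun y hy => ?_) (hint₂.sub hint₁)
    have hy0 := hpos y hy
    refine ((h.hasDerivAt_snd y hy0).div (hasDerivAt_id y) hy0.ne').congr_deriv ?_
    simp only [id]
    field_simp
    ring
  rw [intervalIntegral.integral_sub hint₂ hint₁] at hftc
  have hb : |∫ y in x..L, (α + 1) * v y / y ^ 2| ≤ |α + 1| * C * x⁻¹ := by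
    have hpw : ∀ y ∈ Set.Ioc x L, ‖(α + 1) * v y / y ^ 2‖ ≤ |α + 1| * C * y ^ (-2 : ℝ) := by
      intro y hy
      have hy0 := hx.trans hy.1
      rw [Real.rpow_neg hy0.le, Real.rpow_two, norm_div, norm_mul, Real.norm_eq_abs,
        Real.norm_eq_abs, Real.norm_eq_abs, abs_of_pos (pow_pos hy0 2), div_eq_mul_inv]
      gcongr
      exact h.abs_snd_le y hy0
    have h0 : (0 : ℝ) ∉ Set.uIcc x L := fun h0 => (hpos 0 h0).false
    have hle := intervalIntegral.norm_integral_le_of_norm_le (μ := volume) hL (ae_of_all _ hpw)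
      ((intervalIntegral.intervalIntegrable_rpow (Or.inr h0)).const_mul _)
    rw [intervalIntegral.integral_const_mul, integral_rpow (Or.inr ⟨by norm_num, h0⟩)] at hle
    refine hle.trans ?_
    gcongr
    rw [show (-2 : ℝ) + 1 = -1 by norm_num, Real.rpow_neg_one, Real.rpow_neg_one]
    have := inv_pos.2 hL0
    linarith
  have h1 : |v L / L| ≤ C * x⁻¹ := by
    rw [abs_div, abs_of_pos hL0, div_eq_mul_inv]
    gcongr
    exact h.abs_snd_le L hL0
  have h2 : |v x / x| ≤ C * x⁻¹ := by
    rw [abs_div, abs_of_pos hx, div_eq_mul_inv]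
    gcongr
    exact h.abs_snd_le x hx
  rw [abs_le] at *
  constructor <;> linarith

lemma exists_abs_tail_le (h : BoundedBesselPair α δ C u v)
    (hI : ∀ x, 0 < x → Tendsto (fun L => ∫ y in x..L, u y / y) atTop (nhds (I x))) :
    ∃ D, 0 ≤ D ∧ ∀ x, 0 < x → |I x| ≤ D * x ^ (-(1 : ℝ) / 2) := by
  have hC := h.constant_nonneg
  have hinf : ∀ x, 0 < x → |I x| ≤ C * (2 + |α + 1|) * x⁻¹ := fun x hx => by
    refine le_of_tendsto (hI x hx).abs ?_
    filter_upwards [eventually_ge_atTop x] with L hL using h.abs_integral_fst_div_le hx hL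
  refine ⟨C * (2 + |α + 1|) + 4 * C, by positivity, fun x hx => ?_⟩
  have hxp : 0 < x ^ (-(1 : ℝ) / 2) := Real.rpow_pos_of_pos hx _
  rcases le_total 1 x with hx1 | hx1
  · have hle : x⁻¹ ≤ x ^ (-(1 : ℝ) / 2) := by
      rw [← Real.rpow_neg_one]
      exact Real.rpow_le_rpow_of_exponent_le hx1 (by norm_num)
    calc |I x| ≤ C * (2 + |α + 1|) * x⁻¹ := hinf x hx
      _ ≤ C * (2 + |α + 1|) * x ^ (-(1 : ℝ) / 2) := by gcongr
      _ ≤ _ := by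
        gcongr
        linarith
  · have hpw : ∀ y ∈ Set.Ioc x 1, ‖u y / y‖ ≤ 2 * C * y ^ (-(3 : ℝ) / 2) := fun y hy => by
      have hy0 := hx.trans hy.1
      have h1 : (1 : ℝ) ≤ y ^ (-(1 : ℝ) / 2) :=
        Real.one_le_rpow_of_pos_of_le_one_of_nonpos hy0 hy.2 (by norm_num)
      have h2 : y ^ (-δ) ≤ y ^ (-(1 : ℝ) / 2) :=
        Real.rpow_le_rpow_of_exponent_ge hy0 hy.2 (by linarith [h.exponent_lt])
      rw [show -(3 : ℝ) / 2 = -1 / 2 - 1 by norm_num, Real.rpow_sub_one hy0.ne', norm_div,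
        Real.norm_eq_abs, Real.norm_eq_abs, abs_of_pos hy0, mul_div_assoc']
      gcongr
      refine (h.abs_fst_le y hy0).trans ?_
      nlinarith
    have h0 : (0 : ℝ) ∉ Set.uIcc x 1 := fun h0 => by
      rw [Set.uIcc_of_le hx1] at h0
      exact hx.not_ge h0.1
    have hle := intervalIntegral.norm_integral_le_of_norm_le (μ := volume) hx1 (ae_of_all _ hpw)
      ((intervalIntegral.intervalIntegrable_rpow (Or.inr h0)).const_mul _)
    rw [← h.tail_sub_tail hI hx one_pos, intervalIntegral.integral_const_mul,
      integral_rpow (Or.inr ⟨by norm_num, h0⟩), show -(3 : ℝ) / 2 + 1 = -1 / 2 by norm_num,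
      Real.one_rpow, Real.norm_eq_abs] at hle
    have h1 := hinf 1 one_pos
    have h2 : (1 : ℝ) ≤ x ^ (-(1 : ℝ) / 2) :=
      Real.one_le_rpow_of_pos_of_le_one_of_nonpos hx hx1 (by norm_num)
    have h3 : |I x| ≤ |I x - I 1| + |I 1| := by simpa using abs_add_le (I x - I 1) (I 1)
    have h4 : 0 ≤ C * (2 + |α + 1|) := by positivity
    nlinarith

lemma neg_half_lt (h : BoundedBesselPair α δ C u v) : -1 / 2 < α := by
  linarith [h.exponent_lt, h.neg_le_exponent]

lemma one_add_rpow_neg_le_two (h : BoundedBesselPair α δ C u v) {x : ℝ} (hx : 1 ≤ x) :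
    1 + x ^ (-δ) ≤ 2 := by
  linarith [Real.rpow_le_one_of_one_le_of_nonpos hx (neg_nonpos.2 h.exponent_nonneg)]

lemma abs_fst_mul_le (h : BoundedBesselPair α δ C u v) {c x : ℝ} (hc : 0 < c) (hx : 0 < x) :
    |u (c * x)| ≤ C * ((1 + c ^ (-δ)) * (1 + x ^ (-δ))) := by
  refine (h.abs_fst_le _ (mul_pos hc hx)).trans (mul_le_mul_of_nonneg_left ?_ h.constant_nonneg)
  rw [Real.mul_rpow hc.le hx.le]
  nlinarith [Real.rpow_pos_of_pos hc (-δ), Real.rpow_pos_of_pos hx (-δ)]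

lemma abs_fst_mul_le_of_one_le (h : BoundedBesselPair α δ C u v) {b x : ℝ} (hb : 1 ≤ b)
    (hx : 0 < x) : |u (b * x)| ≤ 2 * C * (1 + x ^ (-δ)) := by
  have h1 := h.one_add_rpow_neg_le_two hb
  have h2 := Real.rpow_pos_of_pos hx (-δ)
  calc |u (b * x)| ≤ C * ((1 + b ^ (-δ)) * (1 + x ^ (-δ))) :=
        h.abs_fst_mul_le (one_pos.trans_le hb) hx
    _ ≤ C * (2 * (1 + x ^ (-δ))) := by
        have := h.constant_nonneg
        gcongr
    _ = _ := by ring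

lemma intervalIntegrable_sq_weight (h : BoundedBesselPair α δ C u v) {L : ℝ} (hL : 0 ≤ L) :
    IntervalIntegrable (fun x : ℝ => (1 + x ^ (-δ)) ^ 2) volume 0 L := by
  have h1 : -1 < -δ := by linarith [h.exponent_lt]
  have h2 : -1 < -δ + -δ := by linarith [h.exponent_lt]
  refine (((intervalIntegrable_const (c := (1 : ℝ))).add
    ((intervalIntegral.intervalIntegrable_rpow' h1).const_mul 2)).add
      (intervalIntegral.intervalIntegrable_rpow' h2)).congr fun x hx => ?_
  rw [Set.uIoc_of_le hL] at hx
  simp only [Real.rpow_add hx.1]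
  ring

lemma intervalIntegrable_rpow_mul_weight (h : BoundedBesselPair α δ C u v) :
    IntervalIntegrable (fun c : ℝ => c ^ α * (1 + c ^ (-δ))) volume 0 1 := by
  have h1 : -1 < α := by linarith [h.neg_half_lt]
  have h2 : -1 < α + -δ := by linarith [h.exponent_lt, h.neg_half_lt]
  refine ((intervalIntegral.intervalIntegrable_rpow' h1).add
      (intervalIntegral.intervalIntegrable_rpow' h2)).congr fun x hx => ?_
  rw [Set.uIoc_of_le zero_le_one] at hx
  simp only [Real.rpow_add hx.1]
  ring

lemma continuousOn_fst_comp (h : BoundedBesselPair α δ C u v) {X : Type*} [TopologicalSpace X]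
    {f : X → ℝ} {s : Set X} (hf : ContinuousOn f s) (hs : ∀ x ∈ s, 0 < f x) :
    ContinuousOn (fun x => u (f x)) s := h.continuousOn_fst.comp hf hs

lemma continuousOn_snd_comp (h : BoundedBesselPair α δ C u v) {X : Type*} [TopologicalSpace X]
    {f : X → ℝ} {s : Set X} (hf : ContinuousOn f s) (hs : ∀ x ∈ s, 0 < f x) :
    ContinuousOn (fun x => v (f x)) s := h.continuousOn_snd.comp hf hs

lemma tendsto_rpow_mul_snd (h : BoundedBesselPair α δ C u v) {x : ℝ} (hx : 0 < x) :
    Tendsto (fun c => c ^ α * v (c * x)) (nhdsWithin 0 (Set.Ioi 0)) (nhds 0) := by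
  have hr : 0 < α + (1 - δ) := by linarith [h.exponent_lt, h.neg_half_lt]
  have hlim := (tendsto_rpow_nhdsGT_zero hr).const_mul (C * x ^ (1 - δ))
  rw [mul_zero] at hlim
  refine squeeze_zero_norm' ?_ hlim
  filter_upwards [self_mem_nhdsWithin] with c hc
  have hc : 0 < c := hc
  have h1 := h.abs_snd_le_rpow _ (mul_pos hc hx)
  have h2 := Real.rpow_pos_of_pos hc α
  rw [Real.mul_rpow hc.le hx.le] at h1
  rw [norm_mul, Real.norm_eq_abs, Real.norm_eq_abs, abs_of_pos h2, Real.rpow_add hc]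
  calc c ^ α * |v (c * x)| ≤ c ^ α * (C * (c ^ (1 - δ) * x ^ (1 - δ))) := by gcongr
    _ = _ := by ring

lemma tendsto_rpow_mul_fst (h : BoundedBesselPair α δ C u v) {x : ℝ} (hx : 0 < x) :
    Tendsto (fun c => c ^ (α + 1) * u (c * x)) (nhdsWithin 0 (Set.Ioi 0)) (nhds 0) := by
  have hr : 0 < α + 1 + -δ := by linarith [h.exponent_lt, h.neg_half_lt]
  have hr' : 0 < α + 1 := by linarith [h.neg_half_lt]
  have hlim := ((tendsto_rpow_nhdsGT_zero hr').add
    (tendsto_rpow_nhdsGT_zero hr)).const_mul (C * (1 + x ^ (-δ)))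
  rw [add_zero, mul_zero] at hlim
  refine squeeze_zero_norm' ?_ hlim
  filter_upwards [self_mem_nhdsWithin] with c hc
  have hc : 0 < c := hc
  have h1 := h.abs_fst_mul_le hc hx
  have h2 := Real.rpow_pos_of_pos hc (α + 1)
  rw [norm_mul, Real.norm_eq_abs, Real.norm_eq_abs, abs_of_pos h2, Real.rpow_add hc (α + 1)]
  calc c ^ (α + 1) * |u (c * x)|
      ≤ c ^ (α + 1) * (C * ((1 + c ^ (-δ)) * (1 + x ^ (-δ)))) := by gcongr
    _ = _ := by ring

lemma tendsto_snd_mul_fst (h : BoundedBesselPair α δ C u v) {b c : ℝ} (hb : 0 < b) (hc : 0 < c) :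
    Tendsto (fun x => v (c * x) * u (b * x)) (nhdsWithin 0 (Set.Ioi 0)) (nhds 0) := by
  have hr : 0 < 1 - δ := by linarith [h.exponent_lt]
  have hr' : 0 < 1 - δ + -δ := by linarith [h.exponent_lt]
  have hlim := ((tendsto_rpow_nhdsGT_zero hr).add
    (tendsto_rpow_nhdsGT_zero hr')).const_mul (C * c ^ (1 - δ) * (C * (1 + b ^ (-δ))))
  rw [add_zero, mul_zero] at hlim
  refine squeeze_zero_norm' ?_ hlim
  filter_upwards [self_mem_nhdsWithin] with x hx
  have hx : 0 < x := hx
  have h1 := h.abs_snd_le_rpow _ (mul_pos hc hx)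
  have h2 := h.abs_fst_mul_le hb hx
  rw [Real.mul_rpow hc.le hx.le] at h1
  rw [norm_mul, Real.norm_eq_abs, Real.norm_eq_abs, Real.rpow_add hx]
  calc |v (c * x)| * |u (b * x)|
      ≤ (C * (c ^ (1 - δ) * x ^ (1 - δ))) * (C * ((1 + b ^ (-δ)) * (1 + x ^ (-δ)))) := by
        gcongr
        exact (abs_nonneg _).trans h1
    _ = _ := by ring

lemma hasDerivAt_fst_mul (h : BoundedBesselPair α δ C u v) {c x : ℝ} (hc : 0 < c) (hx : 0 < x) :
    HasDerivAt (fun x => u (c * x)) (c * (α * u (c * x) / (c * x) - v (c * x))) x :=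
  ((h.hasDerivAt_fst _ (mul_pos hc hx)).comp x ((hasDerivAt_id x).const_mul c)).congr_deriv
    (by ring)

lemma hasDerivAt_snd_mul (h : BoundedBesselPair α δ C u v) {c x : ℝ} (hc : 0 < c) (hx : 0 < x) :
    HasDerivAt (fun x => v (c * x)) (c * (u (c * x) - α * v (c * x) / (c * x))) x :=
  ((h.hasDerivAt_snd _ (mul_pos hc hx)).comp x ((hasDerivAt_id x).const_mul c)).congr_deriv
    (by ring)

/-- Lommel's integral. -/
lemma integral_fst_mul_fst (h : BoundedBesselPair α δ C u v) {b c L : ℝ} (hb : 0 < b) (hc : 0 < c)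
    (hcb : c ^ 2 - b ^ 2 ≠ 0) (hL : 0 < L) :
    ∫ x in (0 : ℝ)..L, u (c * x) * u (b * x) =
      (c * (v (c * L) * u (b * L)) - b * (v (b * L) * u (c * L))) / (c ^ 2 - b ^ 2) := by
  refine integral_eq_of_hasDerivAt_of_tendsto_zero (F := fun x =>
    (c * (v (c * x) * u (b * x)) - b * (v (b * x) * u (c * x))) / (c ^ 2 - b ^ 2)) hL
    (fun x hx => ?_) ?_ ?_
  · refine (((((h.hasDerivAt_snd_mul hc hx).mul (h.hasDerivAt_fst_mul hb hx)).const_mul c).sub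
      (((h.hasDerivAt_snd_mul hb hx).mul (h.hasDerivAt_fst_mul hc hx)).const_mul b)).div_const
        _).congr_deriv ?_
    field_simp
    ring
  · refine intervalIntegrable_of_abs_le hL.le
      ((h.continuousOn_fst_comp (by fun_prop) fun x hx => mul_pos hc hx.1).mul
        (h.continuousOn_fst_comp (by fun_prop) fun x hx => mul_pos hb hx.1)) (fun x hx => ?_)
      ((h.intervalIntegrable_sq_weight hL.le).const_mul
        (C * (1 + c ^ (-δ)) * (C * (1 + b ^ (-δ)))))
    rw [abs_mul]
    have h1 := h.abs_fst_mul_le hc hx.1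
    calc |u (c * x)| * |u (b * x)|
        ≤ (C * ((1 + c ^ (-δ)) * (1 + x ^ (-δ)))) * (C * ((1 + b ^ (-δ)) * (1 + x ^ (-δ)))) :=
          mul_le_mul h1 (h.abs_fst_mul_le hb hx.1) (abs_nonneg _) ((abs_nonneg _).trans h1)
      _ = _ := by ring
  · have := (((h.tendsto_snd_mul_fst hb hc).const_mul c).sub
      ((h.tendsto_snd_mul_fst hc hb).const_mul b)).div_const (c ^ 2 - b ^ 2)
    simpa using this

lemma intervalIntegrable_rpow_mul_fst (h : BoundedBesselPair α δ C u v) {x : ℝ} (hx : 0 < x) :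
    IntervalIntegrable (fun c => c ^ α * u (c * x)) volume 0 1 := by
  refine intervalIntegrable_of_abs_le zero_le_one
    ((continuousOn_id.rpow_const fun c hc => Or.inl hc.1.ne').mul
      (h.continuousOn_fst_comp (by fun_prop) fun c hc => mul_pos hc.1 hx)) (fun c hc => ?_)
    (h.intervalIntegrable_rpow_mul_weight.const_mul (C * (1 + x ^ (-δ))))
  have h2 := Real.rpow_pos_of_pos hc.1 α
  rw [abs_mul, abs_of_pos h2]
  calc c ^ α * |u (c * x)| ≤ c ^ α * (C * ((1 + c ^ (-δ)) * (1 + x ^ (-δ)))) := by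
        gcongr
        exact h.abs_fst_mul_le hc.1 hx
    _ = _ := by ring

lemma snd_div_eq_integral (h : BoundedBesselPair α δ C u v) {x : ℝ} (hx : 0 < x) :
    v x / x = ∫ c in (0 : ℝ)..1, c ^ α * u (c * x) := by
  have hlim : Tendsto (fun c => c ^ α * v (c * x) / x) (nhdsWithin 0 (Set.Ioi 0)) (nhds 0) := by
    simpa using (h.tendsto_rpow_mul_snd hx).div_const x
  have key := integral_eq_of_hasDerivAt_of_tendsto_zero (F' := fun c => c ^ α * u (c * x))
    one_pos (fun c hc => ?_) (h.intervalIntegrable_rpow_mul_fst hx) hlim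
  · rw [key, Real.one_rpow, one_mul, one_mul]
  · have hv := (h.hasDerivAt_snd _ (mul_pos hc hx)).comp c ((hasDerivAt_id c).mul_const x)
    refine (((Real.hasDerivAt_rpow_const (p := α) (Or.inl hc.ne')).mul hv).div_const
      x).congr_deriv ?_
    rw [Real.rpow_sub_one hc.ne']
    simp only [Function.comp, id]
    field_simp
    ring

lemma abs_snd_div_le (h : BoundedBesselPair α δ C u v) {x : ℝ} (hx : 0 < x) :
    |v x / x| ≤ C * (1 + x ^ (-δ)) := by
  rw [abs_div, abs_of_pos hx, div_le_iff₀ hx]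
  refine (h.abs_snd_le_rpow x hx).trans ?_
  rw [sub_eq_neg_add, Real.rpow_add_one hx.ne', mul_assoc]
  have := h.constant_nonneg
  gcongr
  linarith

lemma integral_snd_div_mul_fst (h : BoundedBesselPair α δ C u v) {b L : ℝ} (hb : 1 < b)
    (hL : 0 < L) :
    ∫ x in (0 : ℝ)..L, v x / x * u (b * x) =
      ∫ c in (0 : ℝ)..1, c ^ α * ((c * (v (c * L) * u (b * L)) - b * (v (b * L) * u (c * L))) /
        (c ^ 2 - b ^ 2)) := by
  have hb0 := one_pos.trans hb
  calc ∫ x in (0 : ℝ)..L, v x / x * u (b * x)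
      = ∫ x in (0 : ℝ)..L, ∫ c in (0 : ℝ)..1, c ^ α * (u (c * x) * u (b * x)) := by
        refine intervalIntegral.integral_congr_ae (ae_of_all _ fun x hx => ?_)
        rw [Set.uIoc_of_le hL.le] at hx
        rw [h.snd_div_eq_integral hx.1, ← intervalIntegral.integral_mul_const]
        simp only [mul_assoc]
    _ = ∫ c in (0 : ℝ)..1, ∫ x in (0 : ℝ)..L, c ^ α * (u (c * x) * u (b * x)) := by
        refine intervalIntegral_swap_of_abs_le hL.le zero_le_one ?_ (fun x hx c hc => ?_)
          ((h.intervalIntegrable_sq_weight hL.le).const_mul (2 * C ^ 2))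
          h.intervalIntegrable_rpow_mul_weight
        · exact (continuousOn_snd.rpow_const fun z hz => Or.inl hz.2.1.ne').mul
            ((h.continuousOn_fst_comp (f := fun z : ℝ × ℝ => z.2 * z.1) (by fun_prop)
              fun z hz => mul_pos hz.2.1 hz.1.1).mul
            (h.continuousOn_fst_comp (f := fun z : ℝ × ℝ => b * z.1) (by fun_prop)
              fun z hz => mul_pos hb0 hz.1.1))
        · have h1 := h.abs_fst_mul_le hc.1 hx.1
          have h2 := Real.rpow_pos_of_pos hc.1 α
          rw [abs_mul, abs_mul, abs_of_pos h2]
          calc c ^ α * (|u (c * x)| * |u (b * x)|)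
              ≤ c ^ α * ((C * ((1 + c ^ (-δ)) * (1 + x ^ (-δ)))) * (2 * C * (1 + x ^ (-δ)))) :=
                mul_le_mul_of_nonneg_left (mul_le_mul h1 (h.abs_fst_mul_le_of_one_le hb.le hx.1)
                  (abs_nonneg _) ((abs_nonneg _).trans h1)) h2.le
            _ = _ := by ring
    _ = _ := by
        refine intervalIntegral.integral_congr_ae (ae_of_all _ fun c hc => ?_)
        rw [Set.uIoc_of_le zero_le_one] at hc
        rw [intervalIntegral.integral_const_mul, h.integral_fst_mul_fst hb0 hc.1 ?_ hL]
        nlinarith [hc.1, hc.2]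

lemma abs_rpow_mul_fst_le (h : BoundedBesselPair α δ C u v) {c L : ℝ} (hc : 0 < c) (hL : 1 ≤ L) :
    |c ^ α * u (c * L)| ≤ 2 * C * (c ^ α * (1 + c ^ (-δ))) := by
  have h2 := Real.rpow_pos_of_pos hc α
  rw [abs_mul, abs_of_pos h2, mul_comm c L]
  calc c ^ α * |u (L * c)| ≤ c ^ α * (2 * C * (1 + c ^ (-δ))) := by
        gcongr
        exact h.abs_fst_mul_le_of_one_le hL hc
    _ = _ := by ring

lemma abs_rpow_mul_snd_le (h : BoundedBesselPair α δ C u v) {c L : ℝ} (hc : 0 < c) (hL : 0 < L) :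
    |c ^ α * v (c * L)| ≤ C * (c ^ α * (1 + c ^ (-δ))) := by
  have h2 := Real.rpow_pos_of_pos hc α
  have h3 := Real.rpow_pos_of_pos hc (-δ)
  have hC := h.constant_nonneg
  rw [abs_mul, abs_of_pos h2]
  calc c ^ α * |v (c * L)| ≤ c ^ α * (C * 1) := by
        rw [mul_one]
        gcongr
        exact h.abs_snd_le _ (mul_pos hc hL)
    _ ≤ c ^ α * (C * (1 + c ^ (-δ))) := by gcongr; linarith
    _ = _ := by ring

section LommelKernel

variable {b κ L : ℝ}

lemma abs_inv_sq_sub_sq_le (hκ : 0 < κ) (hb : 1 + κ ≤ b ^ 2) {c : ℝ} (hc : 0 < c) (hc1 : c ≤ 1) :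
    |(c ^ 2 - b ^ 2)⁻¹| ≤ κ⁻¹ := by
  have hle : κ ≤ b ^ 2 - c ^ 2 := by nlinarith
  rw [abs_inv, abs_sub_comm, abs_of_pos (hκ.trans_le hle)]
  exact inv_anti₀ hκ hle

lemma hasDerivAt_inv_sq_sub_sq {c : ℝ} (hcb : c ^ 2 - b ^ 2 ≠ 0) :
    HasDerivAt (fun c : ℝ => (c ^ 2 - b ^ 2)⁻¹) (-(2 * c) * (c ^ 2 - b ^ 2)⁻¹ ^ 2) c := by
  refine (((hasDerivAt_pow 2 c).sub_const (b ^ 2)).inv hcb).congr_deriv ?_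
  norm_num
  field_simp

lemma tendsto_inv_sq_sub_sq (hb : b ^ 2 ≠ 0) :
    Tendsto (fun c : ℝ => (c ^ 2 - b ^ 2)⁻¹) (nhdsWithin 0 (Set.Ioi 0))
      (nhds ((0 ^ 2 - b ^ 2)⁻¹)) := by
  have hc : ContinuousAt (fun c : ℝ => (c ^ 2 - b ^ 2)⁻¹) 0 :=
    (hasDerivAt_inv_sq_sub_sq (by simpa using hb)).continuousAt
  exact hc.tendsto.mono_left nhdsWithin_le_nhds

lemma sq_sub_sq_ne_zero (hκ : 0 < κ) (hb : 1 + κ ≤ b ^ 2) {c : ℝ} (hc : 0 < c) (hc1 : c ≤ 1) :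
    c ^ 2 - b ^ 2 ≠ 0 := by nlinarith

lemma hasDerivAt_rpow_mul_snd (h : BoundedBesselPair α δ C u v) {c : ℝ} (hc : 0 < c)
    (hL : 0 < L) :
    HasDerivAt (fun c => c ^ α * v (c * L)) (L * (c ^ α * u (c * L))) c := by
  have hv := (h.hasDerivAt_snd _ (mul_pos hc hL)).comp c ((hasDerivAt_id c).mul_const L)
  refine ((Real.hasDerivAt_rpow_const (p := α) (Or.inl hc.ne')).mul hv).congr_deriv ?_
  rw [Real.rpow_sub_one hc.ne']
  simp only [Function.comp, id]
  field_simp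
  ring

lemma hasDerivAt_rpow_mul_fst (h : BoundedBesselPair α δ C u v) {c : ℝ} (hc : 0 < c)
    (hL : 0 < L) :
    HasDerivAt (fun c => c ^ (α + 1) * u (c * L))
      ((2 * α + 1) * (c ^ α * u (c * L)) - L * (c ^ α * (c * v (c * L)))) c := by
  have hu := (h.hasDerivAt_fst _ (mul_pos hc hL)).comp c ((hasDerivAt_id c).mul_const L)
  refine ((Real.hasDerivAt_rpow_const (p := α + 1) (Or.inl hc.ne')).mul hu).congr_deriv ?_
  rw [add_sub_cancel_right, Real.rpow_add_one hc.ne']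
  simp only [Function.comp, id]
  field_simp
  ring

lemma continuousOn_rpow_mul_fst (h : BoundedBesselPair α δ C u v) (hL : 0 < L) :
    ContinuousOn (fun c => c ^ α * u (c * L)) (Set.Ioc 0 1) :=
  (continuousOn_id.rpow_const fun _ hc => Or.inl hc.1.ne').mul
    (h.continuousOn_fst_comp (by fun_prop) fun _ hc => mul_pos hc.1 hL)

lemma continuousOn_rpow_mul_snd (h : BoundedBesselPair α δ C u v) (hL : 0 < L) :
    ContinuousOn (fun c => c ^ α * v (c * L)) (Set.Ioc 0 1) :=
  (continuousOn_id.rpow_const fun _ hc => Or.inl hc.1.ne').mul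
    (h.continuousOn_snd_comp (by fun_prop) fun _ hc => mul_pos hc.1 hL)

lemma continuousOn_inv_sq_sub_sq (hκ : 0 < κ) (hb : 1 + κ ≤ b ^ 2) :
    ContinuousOn (fun c : ℝ => (c ^ 2 - b ^ 2)⁻¹) (Set.Ioc 0 1) :=
  ((continuousOn_pow 2).sub continuousOn_const).inv₀ fun _ hc =>
    sq_sub_sq_ne_zero hκ hb hc.1 hc.2

lemma intervalIntegrable_fst_kernel (h : BoundedBesselPair α δ C u v) (hκ : 0 < κ)
    (hb : 1 + κ ≤ b ^ 2) (hL : 1 ≤ L) :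
    IntervalIntegrable (fun c => c ^ α * u (c * L) * (c ^ 2 - b ^ 2)⁻¹) volume 0 1 := by
  have hL0 := one_pos.trans_le hL
  refine intervalIntegrable_of_abs_le zero_le_one
    ((h.continuousOn_rpow_mul_fst hL0).mul (continuousOn_inv_sq_sub_sq hκ hb)) (fun c hc => ?_)
    (h.intervalIntegrable_rpow_mul_weight.const_mul (2 * C * κ⁻¹))
  have h1 := h.abs_rpow_mul_fst_le hc.1 hL
  rw [abs_mul]
  calc _ ≤ 2 * C * (c ^ α * (1 + c ^ (-δ))) * κ⁻¹ :=
        mul_le_mul h1 (abs_inv_sq_sub_sq_le hκ hb hc.1 hc.2) (abs_nonneg _)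
          ((abs_nonneg _).trans h1)
    _ = _ := by ring

lemma intervalIntegrable_snd_kernel (h : BoundedBesselPair α δ C u v) (hκ : 0 < κ)
    (hb : 1 + κ ≤ b ^ 2) (hL : 0 < L) :
    IntervalIntegrable (fun c => c ^ α * (c * v (c * L)) * (c ^ 2 - b ^ 2)⁻¹) volume 0 1 := by
  have hcont : ContinuousOn (fun c => c * (c ^ α * v (c * L) * (c ^ 2 - b ^ 2)⁻¹)) (Set.Ioc 0 1) :=
    continuousOn_id.mul ((h.continuousOn_rpow_mul_snd hL).mul (continuousOn_inv_sq_sub_sq hκ hb))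
  refine intervalIntegrable_of_abs_le zero_le_one (hcont.congr fun c _ => by ring) (fun c hc => ?_)
    (h.intervalIntegrable_rpow_mul_weight.const_mul (C * κ⁻¹))
  have h1 := h.abs_rpow_mul_snd_le hc.1 hL
  have h2 : |c| ≤ 1 := by rw [abs_of_pos hc.1]; exact hc.2
  have h3 := (abs_nonneg _).trans h1
  rw [mul_left_comm, mul_assoc, abs_mul, abs_mul]
  calc _ ≤ 1 * (C * (c ^ α * (1 + c ^ (-δ))) * κ⁻¹) := by
        have := abs_inv_sq_sub_sq_le hκ hb hc.1 hc.2
        gcongr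
    _ = _ := by ring

lemma abs_integral_fst_kernel_le (h : BoundedBesselPair α δ C u v) (hκ : 0 < κ)
    (hb : 1 + κ ≤ b ^ 2) (hL : 1 ≤ L) :
    |∫ c in (0 : ℝ)..1, c ^ α * u (c * L) * (c ^ 2 - b ^ 2)⁻¹| ≤
      (C * κ⁻¹ + C * 2 * κ⁻¹ ^ 2 * ∫ c in (0 : ℝ)..1, c ^ α * (1 + c ^ (-δ))) / L := by
  have hL0 := one_pos.trans_le hL
  have hF : ∀ c, 0 < c → c ≤ 1 → HasDerivAt (fun c => c ^ α * v (c * L) * (c ^ 2 - b ^ 2)⁻¹)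
      (L * (c ^ α * u (c * L) * (c ^ 2 - b ^ 2)⁻¹) -
        c ^ α * v (c * L) * ((2 * c) * (c ^ 2 - b ^ 2)⁻¹ ^ 2)) c := fun c hc hc1 =>
    ((h.hasDerivAt_rpow_mul_snd hc hL0).mul
      (hasDerivAt_inv_sq_sub_sq (sq_sub_sq_ne_zero hκ hb hc hc1))).congr_deriv (by ring)
  refine abs_integral_le_div_of_hasDerivAt hL0 (fun c hc => hF c hc.1 hc.2.le)
    (hF 1 one_pos le_rfl).continuousAt ?_ ?_ (h.intervalIntegrable_fst_kernel hκ hb hL) ?_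
    (fun c hc => ?_) h.intervalIntegrable_rpow_mul_weight
  · have := (h.tendsto_rpow_mul_snd hL0).mul
      (tendsto_inv_sq_sub_sq (b := b) (by nlinarith))
    rwa [zero_mul] at this
  · rw [Real.one_rpow, one_mul, one_mul, abs_mul]
    exact mul_le_mul (h.abs_snd_le L hL0) (abs_inv_sq_sub_sq_le hκ hb one_pos le_rfl)
      (abs_nonneg _) h.constant_nonneg
  · exact (h.continuousOn_rpow_mul_snd hL0).mul ((continuousOn_const.mul continuousOn_id).mul
      ((continuousOn_inv_sq_sub_sq hκ hb).pow 2))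
  · have h1 := h.abs_rpow_mul_snd_le hc.1 hL0
    have h2 := abs_inv_sq_sub_sq_le hκ hb hc.1 hc.2
    have h3 := (abs_nonneg _).trans h1
    have h4 : |2 * c| ≤ 2 := by rw [abs_of_pos (by linarith [hc.1])]; linarith [hc.2]
    rw [abs_mul, abs_mul (2 * c), abs_pow]
    calc _ ≤ C * (c ^ α * (1 + c ^ (-δ))) * (2 * κ⁻¹ ^ 2) := by gcongr
      _ = _ := by ring

lemma abs_integral_snd_kernel_le (h : BoundedBesselPair α δ C u v) (hκ : 0 < κ)
    (hb : 1 + κ ≤ b ^ 2) (hL : 1 ≤ L) :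
    |∫ c in (0 : ℝ)..1, c ^ α * (c * v (c * L)) * (c ^ 2 - b ^ 2)⁻¹| ≤
      (2 * C * κ⁻¹ + 2 * C * ((2 * α + 1) * κ⁻¹ + 2 * κ⁻¹ ^ 2) *
        ∫ c in (0 : ℝ)..1, c ^ α * (1 + c ^ (-δ))) / L := by
  have hL0 := one_pos.trans_le hL
  have hα : 0 ≤ 2 * α + 1 := by linarith [h.neg_half_lt]
  have hF : ∀ c, 0 < c → c ≤ 1 →
      HasDerivAt (fun c => -(c ^ (α + 1) * u (c * L) * (c ^ 2 - b ^ 2)⁻¹))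
      (L * (c ^ α * (c * v (c * L)) * (c ^ 2 - b ^ 2)⁻¹) -
        c ^ α * u (c * L) * ((2 * α + 1) * (c ^ 2 - b ^ 2)⁻¹ -
          2 * c * c * (c ^ 2 - b ^ 2)⁻¹ ^ 2)) c := fun c hc hc1 =>
    ((h.hasDerivAt_rpow_mul_fst hc hL0).mul
      (hasDerivAt_inv_sq_sub_sq (sq_sub_sq_ne_zero hκ hb hc hc1))).neg.congr_deriv (by
        rw [Real.rpow_add_one hc.ne']
        ring)
  refine abs_integral_le_div_of_hasDerivAt hL0 (fun c hc => hF c hc.1 hc.2.le)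
    (hF 1 one_pos le_rfl).continuousAt ?_ ?_ (h.intervalIntegrable_snd_kernel hκ hb hL0) ?_
    (fun c hc => ?_) h.intervalIntegrable_rpow_mul_weight
  · have := ((h.tendsto_rpow_mul_fst hL0).mul
      (tendsto_inv_sq_sub_sq (b := b) (by nlinarith))).neg
    rwa [zero_mul, neg_zero] at this
  · rw [Real.one_rpow, one_mul, one_mul, abs_neg, abs_mul]
    have hC := h.constant_nonneg
    have h1 : |u L| ≤ 2 * C := by
      have := h.one_add_rpow_neg_le_two hL
      have := h.abs_fst_le L hL0
      nlinarith
    exact mul_le_mul h1 (abs_inv_sq_sub_sq_le hκ hb one_pos le_rfl) (abs_nonneg _) (by positivity)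
  · exact (h.continuousOn_rpow_mul_fst hL0).mul
      ((continuousOn_const.mul (continuousOn_inv_sq_sub_sq hκ hb)).sub
        (((continuousOn_const.mul continuousOn_id).mul continuousOn_id).mul
          ((continuousOn_inv_sq_sub_sq hκ hb).pow 2)))
  · have h1 := h.abs_rpow_mul_fst_le hc.1 hL
    have h2 := abs_inv_sq_sub_sq_le hκ hb hc.1 hc.2
    have h3 := (abs_nonneg _).trans h1
    have h4 : |2 * c * c| ≤ 2 := by
      rw [abs_of_pos (by nlinarith [hc.1])]
      nlinarith [hc.1, hc.2]
    have h5 : |(2 * α + 1) * (c ^ 2 - b ^ 2)⁻¹ - 2 * c * c * (c ^ 2 - b ^ 2)⁻¹ ^ 2| ≤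
        (2 * α + 1) * κ⁻¹ + 2 * κ⁻¹ ^ 2 := by
      refine (abs_sub _ _).trans ?_
      rw [abs_mul, abs_mul (2 * c * c), abs_pow, abs_of_nonneg hα]
      gcongr
    rw [abs_mul]
    calc _ ≤ 2 * C * (c ^ α * (1 + c ^ (-δ))) * ((2 * α + 1) * κ⁻¹ + 2 * κ⁻¹ ^ 2) := by gcongr
      _ = _ := by ring

lemma exists_abs_integral_snd_div_mul_fst_le (h : BoundedBesselPair α δ C u v) {s t : ℝ}
    (hs : 1 < s) : ∃ D, ∀ b ∈ Set.Icc s t, ∀ L, 1 ≤ L →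
      |∫ x in (0 : ℝ)..L, v x / x * u (b * x)| ≤ D / L := by
  have hκ : 0 < s ^ 2 - 1 := by nlinarith
  set κ := s ^ 2 - 1 with hκdef
  set W := ∫ c in (0 : ℝ)..1, c ^ α * (1 + c ^ (-δ))
  set K₁ := C * κ⁻¹ + C * 2 * κ⁻¹ ^ 2 * W
  set K₂ := 2 * C * κ⁻¹ + 2 * C * ((2 * α + 1) * κ⁻¹ + 2 * κ⁻¹ ^ 2) * W
  refine ⟨2 * C * K₂ + t * C * K₁, fun b hb L hL => ?_⟩
  have hL0 := one_pos.trans_le hL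
  have hb1 : 1 < b := hs.trans_le hb.1
  have hbκ : 1 + κ ≤ b ^ 2 := by nlinarith [hb.1]
  have hC := h.constant_nonneg
  have hsplit : ∫ x in (0 : ℝ)..L, v x / x * u (b * x) =
      u (b * L) * (∫ c in (0 : ℝ)..1, c ^ α * (c * v (c * L)) * (c ^ 2 - b ^ 2)⁻¹) -
        b * v (b * L) * ∫ c in (0 : ℝ)..1, c ^ α * u (c * L) * (c ^ 2 - b ^ 2)⁻¹ := by
    rw [h.integral_snd_div_mul_fst hb1 hL0, ← intervalIntegral.integral_const_mul,
      ← intervalIntegral.integral_const_mul, ← intervalIntegral.integral_sub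
        ((h.intervalIntegrable_snd_kernel hκ hbκ hL0).const_mul _)
        ((h.intervalIntegrable_fst_kernel hκ hbκ hL).const_mul _)]
    refine intervalIntegral.integral_congr fun c _ => ?_
    simp only [div_eq_mul_inv]
    ring
  have h1 := h.abs_integral_snd_kernel_le hκ hbκ hL
  have h2 := h.abs_integral_fst_kernel_le hκ hbκ hL
  have h3 : |u (b * L)| ≤ 2 * C := by
    have hbL : 1 ≤ b * L := by nlinarith
    have := h.one_add_rpow_neg_le_two hbL
    have := h.abs_fst_le (b * L) (by linarith)
    nlinarith
  have h4 : |b * v (b * L)| ≤ t * C := by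
    rw [abs_mul, abs_of_pos (by linarith)]
    exact mul_le_mul hb.2 (h.abs_snd_le _ (by nlinarith)) (abs_nonneg _) (by linarith [hb.2])
  rw [hsplit]
  refine (abs_sub _ _).trans ?_
  rw [abs_mul, abs_mul (b * v (b * L))]
  calc _ ≤ 2 * C * (K₂ / L) + t * C * (K₁ / L) := by
        have h5 := (abs_nonneg _).trans h4
        gcongr
    _ = _ := by ring

end LommelKernel

lemma integrableOn_dominator (h : BoundedBesselPair α δ C u v) :
    IntegrableOn (fun x => |v x| * x ^ (-(3 : ℝ) / 2)) (Set.Ioi 0) := by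
  have hcont : ContinuousOn (fun x => |v x| * x ^ (-(3 : ℝ) / 2)) (Set.Ioi 0) :=
    h.continuousOn_snd.abs.mul (continuousOn_id.rpow_const fun x hx => Or.inl (ne_of_gt hx))
  rw [← Set.Ioc_union_Ioi_eq_Ioi zero_le_one, integrableOn_union]
  constructor
  · rw [← intervalIntegrable_iff_integrableOn_Ioc_of_le zero_le_one]
    refine intervalIntegrable_of_abs_le zero_le_one (hcont.mono fun x hx => hx.1)
      (fun x hx => ?_) ((intervalIntegral.intervalIntegrable_rpow'
        (r := 1 - δ + -3 / 2) (by linarith [h.exponent_lt])).const_mul C)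
    have h1 := Real.rpow_pos_of_pos hx.1 (-(3 : ℝ) / 2)
    rw [abs_mul, abs_abs, abs_of_pos h1, Real.rpow_add hx.1, ← mul_assoc]
    gcongr
    exact h.abs_snd_le_rpow x hx.1
  · refine ((integrableOn_Ioi_rpow_of_lt (a := -(3 : ℝ) / 2) (by norm_num) one_pos).const_mul
      C).mono' ((hcont.mono (Set.Ioi_subset_Ioi zero_le_one)).aestronglyMeasurable
        measurableSet_Ioi) ((ae_restrict_iff' measurableSet_Ioi).2 (ae_of_all _ fun x hx => ?_))
    have hx0 : (0 : ℝ) < x := one_pos.trans hx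
    have h1 := Real.rpow_pos_of_pos hx0 (-(3 : ℝ) / 2)
    rw [Real.norm_eq_abs, abs_mul, abs_abs, abs_of_pos h1]
    gcongr
    exact h.abs_snd_le x hx0

lemma abs_snd_div_mul_tail_le {D : ℝ} (hD : ∀ x, 0 < x → |I x| ≤ D * x ^ (-(1 : ℝ) / 2))
    {t x : ℝ} (ht : 0 < t) (hx : 0 < x) :
    |v x / x * I (t * x)| ≤ D * t ^ (-(1 : ℝ) / 2) * (|v x| * x ^ (-(3 : ℝ) / 2)) := by
  have h1 := hD (t * x) (mul_pos ht hx)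
  rw [Real.mul_rpow ht.le hx.le] at h1
  rw [show -(3 : ℝ) / 2 = -1 / 2 - 1 by norm_num, Real.rpow_sub_one hx.ne', abs_mul, abs_div,
    abs_of_pos hx]
  calc |v x| / x * |I (t * x)| ≤ |v x| / x * (D * (t ^ (-(1 : ℝ) / 2) * x ^ (-(1 : ℝ) / 2))) := by
        gcongr
    _ = _ := by ring

lemma continuousOn_snd_div_mul_tail (h : BoundedBesselPair α δ C u v)
    (hI : ContinuousOn I (Set.Ioi 0)) {t : ℝ} (ht : 0 < t) :
    ContinuousOn (fun x => v x / x * I (t * x)) (Set.Ioi 0) :=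
  (h.continuousOn_snd.div continuousOn_id fun x hx => ne_of_gt hx).mul
    (hI.comp (by fun_prop) fun x hx => mul_pos ht hx)

lemma integrableOn_snd_div_mul_tail (h : BoundedBesselPair α δ C u v)
    (hI : ContinuousOn I (Set.Ioi 0)) {D : ℝ}
    (hD : ∀ x, 0 < x → |I x| ≤ D * x ^ (-(1 : ℝ) / 2)) {t : ℝ} (ht : 0 < t) :
    IntegrableOn (fun x => v x / x * I (t * x)) (Set.Ioi 0) :=
  (h.integrableOn_dominator.const_mul (D * t ^ (-(1 : ℝ) / 2))).mono'
    ((h.continuousOn_snd_div_mul_tail hI ht).aestronglyMeasurable measurableSet_Ioi)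
    ((ae_restrict_iff' measurableSet_Ioi).2
      (ae_of_all _ fun _ hx => abs_snd_div_mul_tail_le hD ht hx))

lemma integral_snd_div_mul_tail_sub (h : BoundedBesselPair α δ C u v)
    (hI : ∀ x, 0 < x → Tendsto (fun L => ∫ y in x..L, u y / y) atTop (nhds (I x)))
    {s t L : ℝ} (hs : 1 < s) (hst : s ≤ t) (hL : 0 < L) :
    ∫ x in (0 : ℝ)..L, v x / x * (I (s * x) - I (t * x)) =
      ∫ b in s..t, b⁻¹ * ∫ x in (0 : ℝ)..L, v x / x * u (b * x) := by
  have hs0 := one_pos.trans hs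
  calc ∫ x in (0 : ℝ)..L, v x / x * (I (s * x) - I (t * x))
      = ∫ x in (0 : ℝ)..L, ∫ b in s..t, b⁻¹ * (v x / x * u (b * x)) := by
        refine intervalIntegral.integral_congr_ae (ae_of_all _ fun x hx => ?_)
        rw [Set.uIoc_of_le hL.le] at hx
        have hx0 := hx.1
        have hsub := intervalIntegral.integral_comp_mul_right (a := s) (b := t)
          (fun y => u y / y) hx0.ne'
        rw [h.tail_sub_tail hI (mul_pos hs0 hx0) (mul_pos (hs0.trans_le hst) hx0),
          ← one_mul (∫ y in _.._, u y / y), ← mul_inv_cancel₀ hx0.ne', mul_assoc, ← smul_eq_mul x⁻¹,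
          ← hsub, ← mul_assoc, ← intervalIntegral.integral_const_mul]
        refine intervalIntegral.integral_congr fun b _ => ?_
        field_simp
    _ = ∫ b in s..t, ∫ x in (0 : ℝ)..L, b⁻¹ * (v x / x * u (b * x)) := by
        refine intervalIntegral_swap_of_abs_le (q := fun _ => 1) hL.le hst ?_ (fun x hx b hb => ?_)
          ((h.intervalIntegrable_sq_weight hL.le).const_mul (2 * C ^ 2)) intervalIntegrable_const
        · refine (continuousOn_snd.inv₀ fun z hz => (hs0.trans hz.2.1).ne').mul
            (((h.continuousOn_snd_comp continuousOn_fst fun z hz => hz.1.1).div continuousOn_fst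
              fun z hz => hz.1.1.ne').mul
            (h.continuousOn_fst_comp (f := fun z : ℝ × ℝ => z.2 * z.1) (by fun_prop)
              fun z hz => mul_pos (hs0.trans hz.2.1) hz.1.1))
        · have hb1 : 1 ≤ b := (hs.trans hb.1).le
          have h1 := h.abs_snd_div_le hx.1
          have h2 : |b⁻¹| ≤ 1 := by
            rw [abs_inv, abs_of_pos (one_pos.trans_le hb1)]
            exact inv_le_one_of_one_le₀ hb1
          rw [abs_mul, abs_mul]
          calc |b⁻¹| * (|v x / x| * |u (b * x)|)
              ≤ 1 * ((C * (1 + x ^ (-δ))) * (2 * C * (1 + x ^ (-δ)))) :=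
                mul_le_mul h2 (mul_le_mul h1 (h.abs_fst_mul_le_of_one_le hb1 hx.1)
                  (abs_nonneg _) ((abs_nonneg _).trans h1)) (by positivity) zero_le_one
            _ = _ := by ring
    _ = _ := by simp only [intervalIntegral.integral_const_mul]

lemma integral_snd_div_mul_tail_eq (h : BoundedBesselPair α δ C u v)
    (hI : ∀ x, 0 < x → Tendsto (fun L => ∫ y in x..L, u y / y) atTop (nhds (I x)))
    {s t : ℝ} (hs : 1 < s) (hst : s ≤ t) :
    ∫ x in Set.Ioi 0, v x / x * I (s * x) = ∫ x in Set.Ioi 0, v x / x * I (t * x) := by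
  have hs0 := one_pos.trans hs
  have hIc := h.continuousOn_tail hI
  obtain ⟨D, -, hD⟩ := h.exists_abs_tail_le hI
  obtain ⟨K, hK⟩ := h.exists_abs_integral_snd_div_mul_fst_le (t := t) hs
  have hints := h.integrableOn_snd_div_mul_tail hIc hD hs0
  have hintt := h.integrableOn_snd_div_mul_tail hIc hD (hs0.trans_le hst)
  rw [← sub_eq_zero, ← integral_sub hints hintt]
  refine tendsto_nhds_unique
    (intervalIntegral_tendsto_integral_Ioi 0 (hints.sub hintt) tendsto_id) ?_
  have hlim : Tendsto (fun L : ℝ => K / L * |t - s|) atTop (nhds 0) := by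
    simpa using (tendsto_const_nhds.div_atTop tendsto_id).mul_const |t - s|
  refine squeeze_zero_norm' ?_ hlim
  filter_upwards [eventually_ge_atTop 1] with L hL
  simp only [id, ← mul_sub]
  rw [h.integral_snd_div_mul_tail_sub hI hs hst (one_pos.trans_le hL)]
  refine intervalIntegral.norm_integral_le_of_norm_le_const fun b hb => ?_
  rw [Set.uIoc_of_le hst] at hb
  have hb1 : 1 ≤ b := (hs.trans hb.1).le
  rw [norm_mul, Real.norm_eq_abs, Real.norm_eq_abs, abs_inv, abs_of_pos (one_pos.trans_le hb1)]
  exact (mul_le_of_le_one_left (abs_nonneg _) (inv_le_one_of_one_le₀ hb1)).trans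
    (hK b ⟨hb.1.le, hb.2⟩ L hL)

lemma integral_snd_div_mul_tail_eq_zero_of_one_lt (h : BoundedBesselPair α δ C u v)
    (hI : ∀ x, 0 < x → Tendsto (fun L => ∫ y in x..L, u y / y) atTop (nhds (I x)))
    {s : ℝ} (hs : 1 < s) : ∫ x in Set.Ioi 0, v x / x * I (s * x) = 0 := by
  obtain ⟨D, -, hD⟩ := h.exists_abs_tail_le hI
  have hlim : Tendsto (fun t : ℝ => D * t ^ (-(1 / 2 : ℝ)) *
      ∫ x in Set.Ioi 0, |v x| * x ^ (-(3 : ℝ) / 2)) atTop (nhds 0) := by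
    simpa using ((tendsto_rpow_neg_atTop (y := 1 / 2) (by norm_num)).const_mul D).mul_const _
  refine tendsto_nhds_unique (f := fun t : ℝ => ∫ x in Set.Ioi 0, v x / x * I (t * x))
    (l := atTop) (tendsto_const_nhds.congr' ?_) (squeeze_zero_norm' ?_ hlim)
  · filter_upwards [eventually_ge_atTop s] with t ht
    exact h.integral_snd_div_mul_tail_eq hI hs ht
  · filter_upwards [eventually_gt_atTop 0] with t ht
    rw [← MeasureTheory.integral_const_mul]
    refine norm_integral_le_of_norm_le (h.integrableOn_dominator.const_mul _)
      ((ae_restrict_iff' measurableSet_Ioi).2 (ae_of_all _ fun x hx => ?_))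
    rw [← neg_div]
    exact abs_snd_div_mul_tail_le hD ht hx

lemma integral_snd_div_mul_tail_eq_zero (h : BoundedBesselPair α δ C u v)
    (hI : ∀ x, 0 < x → Tendsto (fun L => ∫ y in x..L, u y / y) atTop (nhds (I x))) :
    ∫ x in Set.Ioi 0, v x / x * I x = 0 := by
  obtain ⟨D, hD0, hD⟩ := h.exists_abs_tail_le hI
  have hIc := h.continuousOn_tail hI
  have hlim : Tendsto (fun t : ℝ => ∫ x in Set.Ioi 0, v x / x * I (t * x))
      (nhdsWithin 1 (Set.Ioi 1)) (nhds (∫ x in Set.Ioi 0, v x / x * I x)) := by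
    refine tendsto_integral_filter_of_dominated_convergence
      (fun x => D * (|v x| * x ^ (-(3 : ℝ) / 2))) ?_ ?_ (h.integrableOn_dominator.const_mul D)
      ((ae_restrict_iff' measurableSet_Ioi).2 (ae_of_all _ fun x hx => ?_))
    · filter_upwards [self_mem_nhdsWithin] with t ht
      exact (h.continuousOn_snd_div_mul_tail hIc (one_pos.trans ht)).aestronglyMeasurable
        measurableSet_Ioi
    · filter_upwards [self_mem_nhdsWithin] with t ht
      have ht1 : (1 : ℝ) < t := ht
      refine (ae_restrict_iff' measurableSet_Ioi).2 (ae_of_all _ fun x hx => ?_)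
      refine (abs_snd_div_mul_tail_le hD (one_pos.trans ht1) hx).trans ?_
      have h1 : t ^ (-(1 : ℝ) / 2) ≤ 1 :=
        Real.rpow_le_one_of_one_le_of_nonpos ht1.le (by norm_num)
      have h2 : 0 ≤ |v x| * x ^ (-(3 : ℝ) / 2) :=
        mul_nonneg (abs_nonneg _) (Real.rpow_nonneg (Set.mem_Ioi.1 hx).le _)
      exact mul_le_mul_of_nonneg_right (mul_le_of_le_one_right hD0 h1) h2
    · have hcomp : ContinuousAt (fun t : ℝ => I (t * x)) 1 :=
        ContinuousAt.comp (g := I) (f := fun t : ℝ => t * x)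
          (by simpa using hIc.continuousAt (Ioi_mem_nhds hx)) (by fun_prop)
      have := Tendsto.const_mul (v x / x)
        (hcomp.tendsto.mono_left (nhdsWithin_le_nhds (s := Set.Ioi 1)))
      rwa [one_mul] at this
  refine tendsto_nhds_unique hlim (tendsto_const_nhds.congr' ?_)
  filter_upwards [self_mem_nhdsWithin] with t ht
  exact (h.integral_snd_div_mul_tail_eq_zero_of_one_lt hI ht).symm

lemma tendsto_integral_snd_div_mul_tail (h : BoundedBesselPair α δ C u v)
    (hI : ∀ x, 0 < x → Tendsto (fun L => ∫ y in x..L, u y / y) atTop (nhds (I x))) :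
    Tendsto (fun L => ∫ x in (0 : ℝ)..L, v x / x * I x) atTop (nhds 0) := by
  obtain ⟨D, -, hD⟩ := h.exists_abs_tail_le hI
  have hint := h.integrableOn_snd_div_mul_tail (h.continuousOn_tail hI) hD one_pos
  simp only [one_mul] at hint
  have := intervalIntegral_tendsto_integral_Ioi 0 hint tendsto_id
  rwa [h.integral_snd_div_mul_tail_eq_zero hI] at this

end BoundedBesselPair

theorem stmt9 (α : ℝ) (hα : -1 / 2 < α) (I₂ : ℝ → ℝ)
    (hI₂ : ∀ x : ℝ, 0 < x →
      Filter.Tendsto (fun L : ℝ => ∫ y in x..L, y ^ (-(1 : ℝ) / 2) * besselJ (α - 1 / 2) y)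
        Filter.atTop (nhds (I₂ x))) :
    Filter.Tendsto
      (fun L : ℝ => ∫ x in (0 : ℝ)..L, x ^ (-(1 : ℝ) / 2) * besselJ (α + 1 / 2) x * I₂ x)
      Filter.atTop (nhds 0) := by
  obtain ⟨A, hA⟩ := exists_abs_mul_rpow_neg_half_mul_besselJ_le (ν := α - 1 / 2) (by linarith)
  obtain ⟨B, hB⟩ := exists_abs_mul_rpow_neg_half_mul_besselJ_le (ν := α + 1 / 2) (by linarith)
  rw [sub_add_cancel] at hA
  rw [add_assoc, add_halves] at hB
  obtain ⟨δ, C, h⟩ := (isBesselPair_besselJ hα).exists_boundedBesselPair hα hA hB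
  refine (h.tendsto_integral_snd_div_mul_tail (I := I₂) fun x hx =>
    (hI₂ x hx).congr' ?_).congr' ?_
  · filter_upwards [eventually_gt_atTop 0] with L hL
    refine intervalIntegral.integral_congr fun y hy => ?_
    exact (mul_div_cancel_left₀ _ ((lt_min hx hL).trans_le hy.1).ne').symm
  · filter_upwards [eventually_gt_atTop 0] with L hL
    refine intervalIntegral.integral_congr_ae (ae_of_all _ fun x hx => ?_)
    rw [Set.uIoc_of_le hL.le] at hx
    rw [mul_div_cancel_left₀ _ hx.1.ne']
end

section
/- Let g(x,y) = |x|^α |y|^β h(x,y) with h smooth and compactly supported, α, β, α+β > -1. Then both iterated principal value integrals p.v.∫ (p.v.∫ g(x,y)Sign(x-y)/(xy) dx) dy and p.v.∫ (p.v.∫ g(x,y)Sign(x-y)/(xy) dy) dx exist and equal the symmetric double principal value p.v.∬ g(x,y)Sign(x-y)/(xy) dx dy. -/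
open MeasureTheory Real Filter Set

/-- The interval `[-1, 1]` with the symmetric neighbourhood `[-ε, ε]` of the origin removed. -/
def puncturedInterval (ε : ℝ) : Set ℝ := {x : ℝ | ε < |x| ∧ |x| ≤ 1}

lemma measurableSet_puncturedInterval (ε : ℝ) : MeasurableSet (puncturedInterval ε) :=
  (measurableSet_lt measurable_const measurable_abs).inter
    (measurableSet_le measurable_abs measurable_const)

lemma puncturedInterval_eq_union {ε : ℝ} (hε : 0 ≤ ε) :
    puncturedInterval ε = Ioc ε 1 ∪ Neg.neg ⁻¹' Ioc ε 1 := by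
  ext x
  simp only [puncturedInterval, mem_ofPred_eq, mem_union, mem_Ioc, mem_preimage]
  rcases abs_cases x with ⟨h, h'⟩ | ⟨h, h'⟩ <;> rw [h] <;> constructor
  · tauto
  · rintro (h | h)
    · exact h
    · linarith
  · tauto
  · rintro (h | h)
    · linarith
    · exact h

lemma integrableOn_comp_neg_Ioc {φ : ℝ → ℝ} {ε : ℝ} (hε : 0 ≤ ε)
    (hφ : IntegrableOn φ (puncturedInterval ε)) :
    IntegrableOn (fun x => φ (-x)) (Ioc ε 1) := by
  rw [puncturedInterval_eq_union hε] at hφ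
  rw [← (Measure.measurePreserving_neg volume).integrableOn_comp_preimage
    (MeasurableEquiv.neg ℝ).measurableEmbedding]
  simpa [Function.comp_def] using hφ.right_of_union

lemma setIntegral_puncturedInterval {φ : ℝ → ℝ} {ε : ℝ} (hε : 0 ≤ ε)
    (hφ : IntegrableOn φ (puncturedInterval ε)) :
    ∫ x in puncturedInterval ε, φ x = ∫ x in Ioc ε 1, (φ x + φ (-x)) := by
  have hn := integrableOn_comp_neg_Ioc hε hφ
  rw [puncturedInterval_eq_union hε] at hφ ⊢
  rw [setIntegral_union _ (measurable_neg measurableSet_Ioc) hφ.left_of_union hφ.right_of_union,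
    integral_add hφ.left_of_union hn]
  · congr 1
    simpa using (Measure.measurePreserving_neg (volume : Measure ℝ)).setIntegral_preimage_emb
      (MeasurableEquiv.neg ℝ).measurableEmbedding (fun x => φ (-x)) (Ioc ε 1)
  · rw [Set.disjoint_left]
    rintro x hx hx'
    have := hx.1
    have := hx'.1
    linarith

lemma tendsto_setIntegral_of_eventually_mem {X : Type*} [MeasurableSpace X] {μ : Measure X}
    {ψ : X → ℝ} {s : ℝ → Set X} {t : Set X} (hs : ∀ ε, MeasurableSet (s ε))
    (ht : MeasurableSet t) (hψ : IntegrableOn ψ t μ) (hst : ∀ ε, 0 < ε → s ε ⊆ t)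
    (hmem : ∀ x ∈ t, ∀ᶠ ε in nhdsWithin (0 : ℝ) (Ioi 0), x ∈ s ε) :
    Tendsto (fun ε => ∫ x in s ε, ψ x ∂μ) (nhdsWithin 0 (Ioi 0)) (nhds (∫ x in t, ψ x ∂μ)) := by
  simp_rw [← integral_indicator (hs _), ← integral_indicator ht]
  have hi : Integrable (t.indicator ψ) μ := (integrable_indicator_iff ht).2 hψ
  refine tendsto_integral_filter_of_dominated_convergence (fun x => ‖t.indicator ψ x‖) ?_ ?_
    hi.norm ?_
  · filter_upwards [self_mem_nhdsWithin] with ε hε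
    exact ((integrable_indicator_iff (hs ε)).2 (hψ.mono_set (hst ε hε))).aestronglyMeasurable
  · filter_upwards [self_mem_nhdsWithin] with ε hε
    refine Eventually.of_forall fun x => ?_
    exact norm_indicator_le_of_subset (hst ε hε) _ _
  · refine Eventually.of_forall fun x => ?_
    by_cases hx : x ∈ t
    · refine tendsto_const_nhds.congr' ?_
      filter_upwards [hmem x hx] with ε h
      rw [indicator_of_mem hx, indicator_of_mem h]
    · refine tendsto_const_nhds.congr' ?_
      filter_upwards [self_mem_nhdsWithin] with ε hε
      rw [indicator_of_notMem hx, indicator_of_notMem fun h => hx (hst ε hε h)]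

lemma eventually_mem_Ioc {x : ℝ} (hx : x ∈ Ioc (0 : ℝ) 1) :
    ∀ᶠ ε in nhdsWithin (0 : ℝ) (Ioi 0), x ∈ Ioc ε 1 := by
  filter_upwards [Ioo_mem_nhdsGT hx.1] with ε hε
  exact ⟨hε.2, hx.2⟩

lemma tendsto_setIntegral_puncturedInterval {φ : ℝ → ℝ}
    (hφ : ∀ ε, 0 < ε → IntegrableOn φ (puncturedInterval ε))
    (hsymm : IntegrableOn (fun x => φ x + φ (-x)) (Ioc 0 1)) :
    Tendsto (fun ε => ∫ x in puncturedInterval ε, φ x) (nhdsWithin 0 (Ioi 0))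
      (nhds (∫ x in Ioc 0 1, (φ x + φ (-x)))) := by
  refine (tendsto_setIntegral_of_eventually_mem (s := fun ε => Ioc ε 1)
    (fun _ => measurableSet_Ioc) measurableSet_Ioc hsymm
    (fun ε hε => Ioc_subset_Ioc_left hε.le) fun x hx => eventually_mem_Ioc hx).congr' ?_
  filter_upwards [self_mem_nhdsWithin] with ε hε
  rw [setIntegral_puncturedInterval (le_of_lt hε) (hφ ε hε)]

/-- Abstract form of the interchange: once the partial and full symmetrizations are integrable,
the double and the iterated principal values agree. -/
lemma exists_tendsto_double_and_iterated {f : ℝ × ℝ → ℝ}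
    (hf : ∀ ε, 0 < ε → IntegrableOn f (puncturedInterval ε ×ˢ puncturedInterval ε))
    (hslice : ∀ y, y ≠ 0 → ∀ ε, 0 < ε →
      IntegrableOn (fun x => f (x, y)) (puncturedInterval ε))
    (hslice_symm : ∀ y, y ≠ 0 → IntegrableOn (fun x => f (x, y) + f (-x, y)) (Ioc 0 1))
    (hsymm : ∀ ε, 0 < ε → IntegrableOn (fun p : ℝ × ℝ => f p + f (-p.1, p.2))
      (Ioc 0 1 ×ˢ puncturedInterval ε))
    (hsymm₂ : IntegrableOn
      (fun p : ℝ × ℝ => f p + f (-p.1, p.2) + (f (p.1, -p.2) + f (-p.1, -p.2)))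
      (Ioc 0 1 ×ˢ Ioc 0 1)) :
    ∃ L : ℝ,
      Tendsto (fun ε => ∫ p in puncturedInterval ε ×ˢ puncturedInterval ε, f p)
        (nhdsWithin 0 (Ioi 0)) (nhds L) ∧
      ∃ F : ℝ → ℝ,
        (∀ y, y ≠ 0 → Tendsto (fun ε => ∫ x in puncturedInterval ε, f (x, y))
          (nhdsWithin 0 (Ioi 0)) (nhds (F y))) ∧
        Tendsto (fun ε => ∫ y in puncturedInterval ε, F y) (nhdsWithin 0 (Ioi 0)) (nhds L) := by
  set S : ℝ × ℝ → ℝ := fun p => f p + f (-p.1, p.2) + (f (p.1, -p.2) + f (-p.1, -p.2)) with hS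
  have ne_of_mem {ε y : ℝ} (hε : 0 ≤ ε) (hy : y ∈ Ioc ε 1) : y ≠ 0 := (hε.trans_lt hy.1).ne'
  refine ⟨∫ p in Ioc 0 1 ×ˢ Ioc 0 1, S p, ?_, fun y => ∫ x in Ioc 0 1, (f (x, y) + f (-x, y)),
    fun y hy => tendsto_setIntegral_puncturedInterval (hslice y hy) (hslice_symm y hy), ?_⟩
  · refine (tendsto_setIntegral_of_eventually_mem (s := fun ε => Ioc ε 1 ×ˢ Ioc ε 1)
      (fun _ => measurableSet_Ioc.prod measurableSet_Ioc)
      (measurableSet_Ioc.prod measurableSet_Ioc) hsymm₂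
      (fun ε hε => prod_mono (Ioc_subset_Ioc_left hε.le) (Ioc_subset_Ioc_left hε.le))
      fun x hx => (eventually_mem_Ioc hx.1).and (eventually_mem_Ioc hx.2)).congr' ?_
    filter_upwards [self_mem_nhdsWithin] with ε (hε : 0 < ε)
    have hfi := hf ε hε
    have hSi : IntegrableOn S (Ioc ε 1 ×ˢ Ioc ε 1) :=
      hsymm₂.mono_set (prod_mono (Ioc_subset_Ioc_left hε.le) (Ioc_subset_Ioc_left hε.le))
    rw [IntegrableOn, Measure.volume_eq_prod, ← Measure.prod_restrict] at hfi hSi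
    rw [Measure.volume_eq_prod, ← Measure.prod_restrict, ← Measure.prod_restrict,
      integral_prod_symm _ hfi, integral_prod_symm _ hSi,
      setIntegral_puncturedInterval hε.le hfi.integral_prod_right]
    refine setIntegral_congr_fun measurableSet_Ioc fun y hy => ?_
    have hy0 := ne_of_mem hε.le hy
    have hsub := Ioc_subset_Ioc_left (b := (1 : ℝ)) hε.le
    simp only [hS]
    rw [setIntegral_puncturedInterval hε.le (hslice y hy0 ε hε),
      setIntegral_puncturedInterval hε.le (hslice (-y) (neg_ne_zero.2 hy0) ε hε),
      integral_add ((hslice_symm y hy0).mono_set hsub)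
        ((hslice_symm (-y) (neg_ne_zero.2 hy0)).mono_set hsub)]
  · have hSi := hsymm₂
    rw [IntegrableOn, Measure.volume_eq_prod, ← Measure.prod_restrict] at hSi
    have hadd : ∀ y ∈ Ioc (0 : ℝ) 1, ∫ x in Ioc 0 1, S (x, y) =
        (∫ x in Ioc 0 1, (f (x, y) + f (-x, y))) + ∫ x in Ioc 0 1, (f (x, -y) + f (-x, -y)) :=
      fun y hy => integral_add (hslice_symm y hy.1.ne')
        (hslice_symm (-y) (neg_ne_zero.2 hy.1.ne'))
    rw [Measure.volume_eq_prod, ← Measure.prod_restrict, integral_prod_symm _ hSi,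
      setIntegral_congr_fun measurableSet_Ioc hadd]
    refine tendsto_setIntegral_puncturedInterval (fun ε hε => ?_) ?_
    · have hk := hsymm ε hε
      rw [IntegrableOn, Measure.volume_eq_prod, ← Measure.prod_restrict] at hk
      exact hk.integral_prod_right
    · exact IntegrableOn.congr_fun hSi.integral_prod_right hadd measurableSet_Ioc

lemma continuousOn_abs_rpow (a : ℝ) : ContinuousOn (fun x : ℝ => |x| ^ a) {0}ᶜ :=
  continuous_abs.continuousOn.rpow_const fun _ hx => Or.inl (abs_ne_zero.2 hx)

lemma ContinuousOn.integrableOn_puncturedInterval {φ : ℝ → ℝ} (hφ : ContinuousOn φ {0}ᶜ) {ε : ℝ}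
    (hε : 0 < ε) : IntegrableOn φ (puncturedInterval ε) := by
  have hK : IsCompact (Icc (-1 : ℝ) 1 ∩ {x | ε ≤ |x|}) :=
    isCompact_Icc.inter_right (isClosed_le continuous_const continuous_abs)
  refine IntegrableOn.mono_set (ContinuousOn.integrableOn_compact hK (hφ.mono ?_)) ?_
  · rintro x ⟨-, hx⟩ rfl
    simp only [mem_ofPred_eq, abs_zero] at hx
    linarith
  · exact fun x hx => ⟨abs_le.1 hx.2, hx.1.le⟩

lemma integrableOn_abs_rpow_Ioc {a : ℝ} (ha : -1 < a) :
    IntegrableOn (fun x : ℝ => |x| ^ a) (Ioc 0 1) := by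
  have h := intervalIntegral.intervalIntegrable_rpow' (a := 0) (b := 1) ha
  rw [intervalIntegrable_iff_integrableOn_Ioc_of_le zero_le_one] at h
  exact h.congr_fun (fun x hx => by simp only [abs_of_pos hx.1]) measurableSet_Ioc

lemma measurable_real_sign : Measurable Real.sign :=
  Measurable.ite measurableSet_Iio measurable_const
    (Measurable.ite measurableSet_Ioi measurable_const measurable_const)

lemma abs_real_sign_le_one (x : ℝ) : |Real.sign x| ≤ 1 := by
  rcases Real.sign_apply_eq x with h | h | h <;> simp [h]

/-- The integrand `|x|^α |y|^β h(x, y) sign(x - y) / (x y)`. -/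
noncomputable def signKernel (α β : ℝ) (h : ℝ × ℝ → ℝ) (p : ℝ × ℝ) : ℝ :=
  |p.1| ^ α * |p.2| ^ β * h p * Real.sign (p.1 - p.2) / (p.1 * p.2)

lemma measurable_signKernel (α β : ℝ) {h : ℝ × ℝ → ℝ} (hh : Measurable h) :
    Measurable (signKernel α β h) := by
  have := measurable_real_sign
  unfold signKernel
  fun_prop

lemma abs_rpow_mul_div_mul (α β N : ℝ) {x y : ℝ} (hx : x ≠ 0) (hy : y ≠ 0) :
    |(|x| ^ α * |y| ^ β * N / (x * y))| = |x| ^ (α - 1) * |y| ^ (β - 1) * |N| := by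
  have hx' := abs_pos.2 hx
  have hy' := abs_pos.2 hy
  rw [abs_div, abs_mul, abs_mul, abs_mul, abs_of_nonneg (rpow_nonneg hx'.le α),
    abs_of_nonneg (rpow_nonneg hy'.le β), rpow_sub_one hx'.ne', rpow_sub_one hy'.ne']
  field_simp

lemma abs_signKernel_le {α β M : ℝ} {h : ℝ × ℝ → ℝ} (hM : ∀ p, |h p| ≤ M) {x y : ℝ}
    (hx : x ≠ 0) (hy : y ≠ 0) :
    |signKernel α β h (x, y)| ≤ |x| ^ (α - 1) * (|y| ^ (β - 1) * M) := by
  have := abs_rpow_mul_div_mul α β (h (x, y) * Real.sign (x - y)) hx hy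
  rw [← mul_assoc] at this
  rw [signKernel, this, mul_assoc]
  gcongr
  rw [abs_mul]
  exact (mul_le_of_le_one_right (abs_nonneg _) (abs_real_sign_le_one _)).trans (hM _)

lemma abs_signKernel_add_le {α β M K : ℝ} {h : ℝ × ℝ → ℝ} (hM : ∀ p, |h p| ≤ M)
    (hK : ∀ p q, |h p - h q| ≤ K * max |p.1 - q.1| |p.2 - q.2|) {x y : ℝ}
    (hx : 0 < x) (hy : y ≠ 0) :
    |signKernel α β h (x, y) + signKernel α β h (-x, y)| ≤
      |x| ^ α * (|y| ^ (β - 1) * (2 * K + 2 * M / |y|)) := by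
  have hy' := abs_pos.2 hy
  have hM0 : 0 ≤ M := (abs_nonneg _).trans (hM 0)
  have hK0 : 0 ≤ K := by simpa using (abs_nonneg _).trans (hK (1, 0) 0)
  set N := h (x, y) * Real.sign (x - y) - h (-x, y) * Real.sign (-x - y) with hN
  have hsum : signKernel α β h (x, y) + signKernel α β h (-x, y) =
      |x| ^ α * |y| ^ β * N / (x * y) := by
    simp only [signKernel, abs_neg, hN]
    field_simp
    ring
  have hNle : |N| ≤ |x| * (2 * K + 2 * M / |y|) := by
    rw [abs_of_pos hx]
    rcases lt_or_ge x |y| with hxy | hxy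
    · have hd := hK (x, y) (-x, y)
      simp only [sub_neg_eq_add, sub_self, abs_zero] at hd
      rw [max_eq_left (abs_nonneg _), abs_of_pos (a := x + x) (by linarith)] at hd
      have hNd : |N| = |h (x, y) - h (-x, y)| := by
        rcases lt_or_gt_of_ne hy with hy0 | hy0
        · rw [abs_of_neg hy0] at hxy
          rw [hN, Real.sign_of_pos (by linarith), Real.sign_of_pos (by linarith)]
          simp
        · rw [abs_of_pos hy0] at hxy
          rw [hN, Real.sign_of_neg (by linarith), Real.sign_of_neg (by linarith), ← abs_neg]
          congr 1
          ring
      have : 0 ≤ x * (2 * M / |y|) := by positivity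
      rw [hNd]
      linarith
    · have h1 : |N| ≤ 2 * M := by
        have ha := mul_le_of_le_one_right (abs_nonneg (h (x, y))) (abs_real_sign_le_one (x - y))
        have hb := mul_le_of_le_one_right (abs_nonneg (h (-x, y)))
          (abs_real_sign_le_one (-x - y))
        rw [← abs_mul] at ha hb
        linarith [abs_sub (h (x, y) * Real.sign (x - y)) (h (-x, y) * Real.sign (-x - y)),
          hM (x, y), hM (-x, y)]
      have h2 : 2 * M ≤ x * (2 * M / |y|) := by
        rw [mul_div_assoc', le_div_iff₀ hy']
        nlinarith
      have : 0 ≤ x * (2 * K) := by positivity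
      linarith
  rw [hsum, abs_rpow_mul_div_mul _ _ _ hx.ne' hy, mul_assoc]
  calc |x| ^ (α - 1) * (|y| ^ (β - 1) * |N|)
      ≤ |x| ^ (α - 1) * (|y| ^ (β - 1) * (|x| * (2 * K + 2 * M / |y|))) := by gcongr
    _ = _ := by
      rw [rpow_sub_one (abs_pos.2 hx.ne').ne']
      have := (abs_pos.2 hx.ne').ne'
      field_simp

lemma abs_signKernel_symm_le {α β K l : ℝ} {h : ℝ × ℝ → ℝ}
    (hK : ∀ p q, |h p - h q| ≤ K * max |p.1 - q.1| |p.2 - q.2|) (hl₀ : 0 ≤ l) (hl₁ : l ≤ 1)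
    {x y : ℝ} (hx : 0 < x) (hy : 0 < y) :
    |signKernel α β h (x, y) + signKernel α β h (-x, y) +
        (signKernel α β h (x, -y) + signKernel α β h (-x, -y))| ≤
      |x| ^ (α - l) * (|y| ^ (β - 1 + l) * (4 * K)) := by
  have hK0 : 0 ≤ K := by simpa using (abs_nonneg _).trans (hK (1, 0) 0)
  set N := (h (x, y) - h (-x, -y)) * Real.sign (x - y) + (h (-x, y) - h (x, -y)) with hN
  have hsum : signKernel α β h (x, y) + signKernel α β h (-x, y) +
        (signKernel α β h (x, -y) + signKernel α β h (-x, -y)) =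
      |x| ^ α * |y| ^ β * N / (x * y) := by
    have h1 : Real.sign (-x - y) = -1 := Real.sign_of_neg (by linarith)
    have h2 : Real.sign (x - -y) = 1 := Real.sign_of_pos (by linarith)
    have h3 : Real.sign (-x - -y) = -Real.sign (x - y) := by
      rw [← Real.sign_neg]
      congr 1
      ring
    simp only [signKernel, abs_neg, hN, h1, h2, h3]
    field_simp
    ring
  have hNle : |N| ≤ 4 * K * min x y := by
    have a1 := hK (x, y) (x, -y)
    have a2 := hK (-x, y) (-x, -y)
    have b1 := hK (x, y) (-x, y)
    have b2 := hK (x, -y) (-x, -y)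
    have c := hK (-x, y) (x, -y)
    have e1 : |x + x| = 2 * x := by rw [abs_of_pos (by linarith)]; ring
    have e2 : |y + y| = 2 * y := by rw [abs_of_pos (by linarith)]; ring
    have e3 : |-x - x| = 2 * x := by rw [abs_of_neg (by linarith)]; ring
    simp only [sub_neg_eq_add, sub_self, abs_zero, e1, e2, e3] at a1 a2 b1 b2 c
    rw [max_eq_right (by linarith)] at a1 a2
    rw [max_eq_left (by linarith)] at b1 b2
    rw [abs_le] at a1 a2 b1 b2 c ⊢
    rcases lt_trichotomy x y with hxy | hxy | hxy
    · rw [hN, Real.sign_of_neg (by linarith), min_eq_left hxy.le]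
      constructor <;> linarith
    · subst hxy
      rw [max_self] at c
      have : 0 ≤ K * x := by positivity
      rw [hN, sub_self, Real.sign_zero, min_self]
      constructor <;> linarith
    · rw [hN, Real.sign_of_pos (by linarith), min_eq_right hxy.le]
      constructor <;> linarith
  have hmin : min x y ≤ x ^ (1 - l) * y ^ l := by
    have hm : 0 < min x y := lt_min hx hy
    calc min x y = min x y ^ (1 - l) * min x y ^ l := by
          rw [← rpow_add hm, sub_add_cancel, rpow_one]
      _ ≤ _ := by
          have h₁ : 0 ≤ 1 - l := by linarith
          have hminx : min x y ≤ x := min_le_left _ _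
          have hminy : min x y ≤ y := min_le_right _ _
          gcongr
  rw [hsum, abs_rpow_mul_div_mul _ _ _ hx.ne' hy.ne', abs_of_pos hx, abs_of_pos hy]
  calc x ^ (α - 1) * y ^ (β - 1) * |N|
      ≤ x ^ (α - 1) * y ^ (β - 1) * (4 * K * (x ^ (1 - l) * y ^ l)) := by
        gcongr
        exact hNle.trans (by gcongr)
    _ = x ^ (α - 1) * x ^ (1 - l) * (y ^ (β - 1) * y ^ l * (4 * K)) := by ring
    _ = _ := by
      rw [← rpow_add hx, ← rpow_add hy]
      rw [show α - 1 + (1 - l) = α - l by ring]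

lemma integrableOn_prod_of_abs_le_mul {g : ℝ × ℝ → ℝ} {u v : ℝ → ℝ} {s t : Set ℝ}
    (hg : Measurable g) (hs : MeasurableSet s) (ht : MeasurableSet t) (hu : IntegrableOn u s)
    (hv : IntegrableOn v t) (hle : ∀ x ∈ s, ∀ y ∈ t, |g (x, y)| ≤ u x * v y) :
    IntegrableOn g (s ×ˢ t) := by
  have huv := Integrable.mul_prod hu hv
  rw [Measure.prod_restrict, ← Measure.volume_eq_prod] at huv
  refine Integrable.mono' huv hg.aestronglyMeasurable ?_
  refine (ae_restrict_iff' (hs.prod ht)).2 (Eventually.of_forall ?_)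
  rintro ⟨x, y⟩ ⟨hx, hy⟩
  exact hle x hx y hy

lemma exists_tendsto_signKernel {α β : ℝ} (hα : -1 < α) (hβ : -1 < β) (hαβ : -1 < α + β)
    {h : ℝ × ℝ → ℝ} {M K : ℝ} (hh : Measurable h) (hM : ∀ p, |h p| ≤ M)
    (hK : ∀ p q, |h p - h q| ≤ K * max |p.1 - q.1| |p.2 - q.2|) :
    ∃ L : ℝ,
      Tendsto (fun ε => ∫ p in puncturedInterval ε ×ˢ puncturedInterval ε, signKernel α β h p)
        (nhdsWithin 0 (Ioi 0)) (nhds L) ∧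
      ∃ F : ℝ → ℝ,
        (∀ y, y ≠ 0 → Tendsto (fun ε => ∫ x in puncturedInterval ε, signKernel α β h (x, y))
          (nhdsWithin 0 (Ioi 0)) (nhds (F y))) ∧
        Tendsto (fun ε => ∫ y in puncturedInterval ε, F y) (nhdsWithin 0 (Ioi 0)) (nhds L) := by
  have hm := measurable_signKernel α β hh
  have hne {ε x : ℝ} (hε : 0 < ε) (hx : x ∈ puncturedInterval ε) : x ≠ 0 :=
    abs_pos.1 (hε.trans hx.1)
  refine exists_tendsto_double_and_iterated (fun ε hε => ?_) (fun y hy ε hε => ?_)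
    (fun y hy => ?_) (fun ε hε => ?_) ?_
  · exact integrableOn_prod_of_abs_le_mul hm (measurableSet_puncturedInterval ε)
      (measurableSet_puncturedInterval ε)
      ((continuousOn_abs_rpow (α - 1)).integrableOn_puncturedInterval hε)
      (((continuousOn_abs_rpow (β - 1)).mul
        continuousOn_const).integrableOn_puncturedInterval hε)
      fun x hx y hy => abs_signKernel_le hM (hne hε hx) (hne hε hy)
  · refine Integrable.mono'
      (((continuousOn_abs_rpow (α - 1)).integrableOn_puncturedInterval hε).mul_const
        (|y| ^ (β - 1) * M)) (Measurable.aestronglyMeasurable (by fun_prop)) ?_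
    refine (ae_restrict_iff' (measurableSet_puncturedInterval ε)).2 (Eventually.of_forall ?_)
    exact fun x hx => abs_signKernel_le hM (hne hε hx) hy
  · refine Integrable.mono' ((integrableOn_abs_rpow_Ioc hα).mul_const
        (|y| ^ (β - 1) * (2 * K + 2 * M / |y|))) (Measurable.aestronglyMeasurable (by fun_prop)) ?_
    refine (ae_restrict_iff' measurableSet_Ioc).2 (Eventually.of_forall ?_)
    exact fun x hx => abs_signKernel_add_le hM hK hx.1 hy
  · refine integrableOn_prod_of_abs_le_mul (by fun_prop) measurableSet_Ioc
      (measurableSet_puncturedInterval ε) (integrableOn_abs_rpow_Ioc hα)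
      (v := fun y => |y| ^ (β - 1) * (2 * K + 2 * M / |y|)) ?_
      fun x hx y hy => abs_signKernel_add_le hM hK hx.1 (hne hε hy)
    refine ContinuousOn.integrableOn_puncturedInterval ?_ hε
    exact (continuousOn_abs_rpow (β - 1)).mul (continuousOn_const.add
      (continuousOn_const.div continuous_abs.continuousOn fun x hx => abs_ne_zero.2 hx))
  · obtain ⟨l, hl⟩ := exists_between (a₁ := max 0 (-β)) (a₂ := min 1 (α + 1)) (by
      simp only [max_lt_iff, lt_min_iff]
      refine ⟨⟨?_, ?_⟩, ?_, ?_⟩ <;> linarith)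
    simp only [max_lt_iff, lt_min_iff] at hl
    exact integrableOn_prod_of_abs_le_mul (by fun_prop) measurableSet_Ioc measurableSet_Ioc
      (integrableOn_abs_rpow_Ioc (a := α - l) (by linarith))
      ((integrableOn_abs_rpow_Ioc (a := β - 1 + l) (by linarith)).mul_const (4 * K))
      fun x hx y hy => abs_signKernel_symm_le hK hl.1.1.le hl.2.1.le hx.1 hy.1

lemma signKernel_swap (α β : ℝ) (h : ℝ × ℝ → ℝ) (p : ℝ × ℝ) :
    signKernel β α (fun q => -h q.swap) p.swap = signKernel α β h p := by
  have : Real.sign (p.2 - p.1) = -Real.sign (p.1 - p.2) := by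
    rw [← Real.sign_neg, neg_sub]
  simp only [signKernel, Prod.fst_swap, Prod.snd_swap, Prod.swap_swap, this]
  ring

lemma setIntegral_prod_self_swap (s : Set ℝ) (f : ℝ × ℝ → ℝ) :
    ∫ p in s ×ˢ s, f p.swap = ∫ p in s ×ˢ s, f p := by
  have := (Measure.measurePreserving_swap (μ := (volume : Measure ℝ))
    (ν := (volume : Measure ℝ))).setIntegral_preimage_emb
      MeasurableEquiv.prodComm.measurableEmbedding f (s ×ˢ s)
  rwa [preimage_swap_prod] at this

open MeasureTheory Real Filter Set
theorem stmt11 (α β : ℝ) (hα : -1 < α) (hβ : -1 < β) (hαβ : -1 < α + β)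
    (h : ℝ × ℝ → ℝ) (hsm : ContDiff ℝ (⊤ : ℕ∞) h) (hcs : HasCompactSupport h) :
    ∃ L : ℝ,
      -- the symmetric double principal value exists and equals L
      Filter.Tendsto
        (fun ε : ℝ =>
          ∫ p in {p : ℝ × ℝ | ε < min |p.1| |p.2| ∧ |p.1| ≤ 1 ∧ |p.2| ≤ 1},
            |p.1| ^ α * |p.2| ^ β * h p * Real.sign (p.1 - p.2) / (p.1 * p.2))
        (nhdsWithin 0 (Set.Ioi 0)) (nhds L) ∧
      -- the iterated p.v. integral, inner in x, exists and equals L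
      (∃ F : ℝ → ℝ,
        (∀ y : ℝ, y ≠ 0 →
          Filter.Tendsto
            (fun ε : ℝ => ∫ x in {x : ℝ | ε < |x| ∧ |x| ≤ 1},
              |x| ^ α * |y| ^ β * h (x, y) * Real.sign (x - y) / (x * y))
            (nhdsWithin 0 (Set.Ioi 0)) (nhds (F y))) ∧
        Filter.Tendsto
          (fun ε : ℝ => ∫ y in {y : ℝ | ε < |y| ∧ |y| ≤ 1}, F y)
          (nhdsWithin 0 (Set.Ioi 0)) (nhds L)) ∧
      -- the iterated p.v. integral, inner in y, exists and equals L
      (∃ G : ℝ → ℝ,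
        (∀ x : ℝ, x ≠ 0 →
          Filter.Tendsto
            (fun ε : ℝ => ∫ y in {y : ℝ | ε < |y| ∧ |y| ≤ 1},
              |x| ^ α * |y| ^ β * h (x, y) * Real.sign (x - y) / (x * y))
            (nhdsWithin 0 (Set.Ioi 0)) (nhds (G x))) ∧
        Filter.Tendsto
          (fun ε : ℝ => ∫ x in {x : ℝ | ε < |x| ∧ |x| ≤ 1}, G x)
          (nhdsWithin 0 (Set.Ioi 0)) (nhds L)) := by
  obtain ⟨M, hM⟩ := hcs.exists_bound_of_continuous hsm.continuous
  obtain ⟨K, hK⟩ := hsm.lipschitzWith_of_hasCompactSupport hcs (by simp)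
  have hM' : ∀ p, |h p| ≤ M := hM
  have hK' : ∀ p q, |h p - h q| ≤ K * max |p.1 - q.1| |p.2 - q.2| := hK.dist_le_mul
  have hmeas := hsm.continuous.measurable
  obtain ⟨L, hL, F, hF, hFL⟩ := exists_tendsto_signKernel hα hβ hαβ hmeas hM' hK'
  obtain ⟨L', hL', G, hG, hGL⟩ := exists_tendsto_signKernel hβ hα (by linarith)
    (h := fun q => -h q.swap) (M := M) (K := K) (by fun_prop)
    (fun p => by simpa using hM' p.swap)
    (fun p q => by
      have := hK' q.swap p.swap
      rw [max_comm, abs_sub_comm q.swap.2, abs_sub_comm q.swap.1] at this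
      simpa [neg_add_eq_sub] using this)
  have hset (ε : ℝ) : {p : ℝ × ℝ | ε < min |p.1| |p.2| ∧ |p.1| ≤ 1 ∧ |p.2| ≤ 1} =
      puncturedInterval ε ×ˢ puncturedInterval ε := by
    ext p
    simp only [puncturedInterval, mem_ofPred_eq, mem_prod, lt_min_iff]
    tauto
  have hLL' : L' = L := by
    refine tendsto_nhds_unique hL' (hL.congr fun ε => ?_)
    rw [← setIntegral_prod_self_swap]
    exact integral_congr_ae (Eventually.of_forall fun p => (signKernel_swap α β h p.swap).symm)
  subst hLL'
  refine ⟨L', ?_, ⟨F, hF, hFL⟩, G, fun x hx => (hG x hx).congr fun ε => ?_, hGL⟩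
  · simp only [hset]
    exact hL
  · exact integral_congr_ae (Eventually.of_forall fun y => signKernel_swap α β h (x, y))
end
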